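/- Chowla–Selberg formula: (2πd)^{12h} · ∏_{[𝔞] ∈ Cl(E)} Δ(𝔞)·Δ(𝔞⁻¹) = ∏_{0 < a < d} Γ(a/d)^{6·w·χ(a)}, where the first product runs over a set of fractional-ideal representatives of the ideal classes of E (its value is independent of the chosen representatives), and Γ is the Gamma function. -/

import Mathlib

open NumberField
open scoped nonZeroDivisors

/-- Ramanujan's modular discriminant `Δ(τ) = q ∏_{n ≥ 1} (1 - qⁿ)^24`, `q = e^{2πiτ}`. -/
noncomputable def RamanujanDelta (τ : ℂ) : ℂ :=
  Complex.exp (2 * Real.pi * Complex.I * τ) *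
    ∏' n : ℕ, (1 - Complex.exp (2 * Real.pi * Complex.I * ((n : ℂ) + 1) * τ)) ^ 24

section
open Filter Topology

namespace CS

/-- The regularised summand. -/
noncomputable def lerchTerm (x : ℝ) (n : ℕ) (s : ℂ) : ℂ :=
  (((n : ℝ) + x : ℝ) : ℂ) ^ (-s) - (((n : ℝ) + 1 : ℝ) : ℂ) ^ (-s)
    - (x - 1) * ((((n : ℝ) + 2 : ℝ) : ℂ) ^ (-s) - (((n : ℝ) + 1 : ℝ) : ℂ) ^ (-s))

lemma interp_bound (g g' g'' : ℝ → ℂ) (a u M : ℝ) (hu : u ∈ Set.Icc (-1 : ℝ) 0)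
    (hg : ∀ t ∈ Set.Icc (a + u) (a + 1), HasDerivAt g (g' t) t)
    (hg' : ∀ t ∈ Set.Icc (a + u) (a + 1), HasDerivAt g' (g'' t) t)
    (hM : ∀ t ∈ Set.Icc (a + u) (a + 1), ‖g'' t‖ ≤ M) :
    ‖g (a + u) - g a - u * (g (a + 1) - g a)‖ ≤ 2 * M := by
  obtain ⟨hu1, hu2⟩ := hu
  have hM0 : 0 ≤ M := (norm_nonneg _).trans (hM a ⟨by linarith, by linarith⟩)
  have hS : Convex ℝ (Set.Icc (a + u) (a + 1)) := convex_Icc _ _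
  have h1 : ∀ t ∈ Set.Icc (a + u) (a + 1), ∀ v ∈ Set.Icc (a + u) (a + 1),
      ‖g' v - g' t‖ ≤ 2 * M := by
    intro t ht v hv
    have := hS.norm_image_sub_le_of_norm_hasDerivWithin_le (f := g') (f' := g'')
      (fun y hy => (hg' y hy).hasDerivWithinAt) hM ht hv
    refine this.trans ?_
    rw [mul_comm]
    gcongr
    rw [Real.norm_eq_abs, abs_le]
    constructor <;> linarith [ht.1, ht.2, hv.1, hv.2]
  have h2 : ∀ t ∈ Set.Icc (a + u) (a + 1), ‖(g (a + 1) - g a) - g' t‖ ≤ 2 * M := by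
    intro t ht
    have := hS.norm_image_sub_le_of_norm_hasDerivWithin_le
      (f := fun v => g v - v * g' t) (f' := fun v => g' v - g' t) (C := 2 * M)
      (x := a) (y := a + 1)
      (fun y hy => by
        have h := (hg y hy).sub ((Complex.ofRealCLM.hasDerivAt (x := y)).mul_const (g' t))
        simp only [Complex.ofRealCLM_apply, Complex.ofReal_one, one_mul] at h
        exact h.hasDerivWithinAt)
      (fun y hy => h1 t ht y hy) ⟨by linarith, by linarith⟩ ⟨by linarith, le_refl _⟩
    simp only [add_sub_cancel_left, norm_one, mul_one] at this
    refine (le_of_eq ?_).trans this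
    congr 1
    push_cast; ring
  have := hS.norm_image_sub_le_of_norm_hasDerivWithin_le
      (f := fun v => g v - v * (g (a + 1) - g a)) (f' := fun v => g' v - (g (a + 1) - g a))
      (C := 2 * M)
      (x := a) (y := a + u)
      (fun y hy => by
        have h := (hg y hy).sub
          ((Complex.ofRealCLM.hasDerivAt (x := y)).mul_const (g (a + 1) - g a))
        simp only [Complex.ofRealCLM_apply, Complex.ofReal_one, one_mul] at h
        exact h.hasDerivWithinAt)
      (fun y hy => by rw [norm_sub_rev]; exact h2 y hy)
      ⟨by linarith, by linarith⟩ ⟨by linarith, by linarith⟩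
  have h3 : ‖a + u - a‖ ≤ 1 := by
    rw [Real.norm_eq_abs, abs_le]; constructor <;> linarith
  calc _ = ‖g (a + u) - ((a + u : ℝ) : ℂ) * (g (a + 1) - g a) -
        (g a - (a : ℂ) * (g (a + 1) - g a))‖ := by congr 1; push_cast; ring
    _ ≤ 2 * M * ‖a + u - a‖ := this
    _ ≤ 2 * M * 1 := by gcongr
    _ = 2 * M := mul_one _

lemma lerchTerm_bound {x : ℝ} (hx0 : 0 < x) (hx1 : x ≤ 1) (n : ℕ) {s : ℂ}
    (hs : -(1 / 2 : ℝ) < s.re) (hs2 : ‖s‖ < 3) :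
    ‖lerchTerm x n s‖ ≤ (24 * x ^ (-(5 : ℝ))) * ((n : ℝ) + 1) ^ (-(3 / 2 : ℝ)) := by
  have hn : (0 : ℝ) ≤ n := n.cast_nonneg
  have hpos : ∀ t ∈ Set.Icc ((n + 1 : ℝ) + (x - 1)) ((n + 1 : ℝ) + 1), 0 < t := by
    intro t ht; have := ht.1; linarith
  have hre : s.re < 3 := (Complex.re_le_norm s).trans_lt hs2
  have key := interp_bound (fun t => (t : ℂ) ^ (-s)) (fun t => (-s) * (t : ℂ) ^ (-s - 1))
    (fun t => (-s) * ((-s - 1) * (t : ℂ) ^ (-s - 1 - 1))) (n + 1) (x - 1)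
    (12 * (x ^ (-(5 : ℝ)) * ((n : ℝ) + 1) ^ (-(3 / 2 : ℝ)))) ⟨by linarith, by linarith⟩
    (fun t ht => by
      have h0 := hpos t ht
      have := ((hasDerivAt_id (t : ℂ)).cpow_const (c := -s)
        (Or.inl (by simpa using h0))).comp_ofReal
      simpa using this)
    (fun t ht => by
      have h0 := hpos t ht
      have := ((hasDerivAt_id (t : ℂ)).cpow_const (c := -s - 1)
        (Or.inl (by simpa using h0))).comp_ofReal
      simpa using this.const_mul (-s))
    (fun t ht => by
      have h0 := hpos t ht
      have h1 : ‖(-s)‖ ≤ 3 := by rw [norm_neg]; exact hs2.le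
      have h2 : ‖-s - 1‖ ≤ 4 := by
        calc ‖-s - 1‖ ≤ ‖-s‖ + ‖(1 : ℂ)‖ := norm_sub_le _ _
          _ ≤ 3 + 1 := by simpa using h1
          _ = 4 := by norm_num
      have h3 : ‖(t : ℂ) ^ (-s - 1 - 1)‖ ≤ x ^ (-(5 : ℝ)) * ((n : ℝ) + 1) ^ (-(3 / 2 : ℝ)) := by
        rw [Complex.norm_cpow_eq_rpow_re_of_pos h0]
        have e : (-s - 1 - 1).re = -(s.re + 2) := by simp; ring
        rw [e]
        have hxt : x * (n + 1) ≤ t := by have := ht.1; nlinarith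
        calc t ^ (-(s.re + 2)) ≤ (x * (n + 1)) ^ (-(s.re + 2)) :=
              Real.rpow_le_rpow_of_nonpos (by positivity) hxt (by linarith)
          _ = x ^ (-(s.re + 2)) * ((n : ℝ) + 1) ^ (-(s.re + 2)) :=
              Real.mul_rpow hx0.le (by positivity)
          _ ≤ _ := by
              gcongr ?_ * ?_
              · exact Real.rpow_le_rpow_of_exponent_ge hx0 hx1 (by linarith)
              · exact Real.rpow_le_rpow_of_exponent_le (by linarith) (by linarith)
      rw [norm_mul, norm_mul]
      calc _ ≤ 3 * (4 * (x ^ (-(5 : ℝ)) * ((n : ℝ) + 1) ^ (-(3 / 2 : ℝ)))) := by gcongr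
        _ = _ := by ring)
  have e1 : ((n : ℝ) + 1) + (x - 1) = n + x := by ring
  have e2 : ((n : ℝ) + 1) + 1 = n + 2 := by ring
  simp only [e1, e2] at key
  unfold lerchTerm
  refine (le_of_eq ?_).trans (key.trans (le_of_eq (by ring)))
  congr 1; push_cast; ring

lemma lerchTerm_hasDerivAt {x : ℝ} (hx0 : 0 < x) (n : ℕ) (s : ℂ) :
    HasDerivAt (lerchTerm x n)
      ((((n : ℝ) + x : ℝ) : ℂ) ^ (-s) * -Complex.log (((n : ℝ) + x : ℝ) : ℂ)
      - (((n : ℝ) + 1 : ℝ) : ℂ) ^ (-s) * -Complex.log (((n : ℝ) + 1 : ℝ) : ℂ)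
      - (x - 1) * ((((n : ℝ) + 2 : ℝ) : ℂ) ^ (-s) * -Complex.log (((n : ℝ) + 2 : ℝ) : ℂ)
        - (((n : ℝ) + 1 : ℝ) : ℂ) ^ (-s) * -Complex.log (((n : ℝ) + 1 : ℝ) : ℂ))) s := by
  have hn : (0 : ℝ) ≤ n := n.cast_nonneg
  have h : ∀ t : ℝ, 0 < t → HasDerivAt (fun s : ℂ => (t : ℂ) ^ (-s))
      ((t : ℂ) ^ (-s) * -Complex.log t) s := by
    intro t ht
    have := (hasDerivAt_neg s).const_cpow (c := (t : ℂ))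
      (Or.inl (by exact_mod_cast ht.ne'))
    simpa using this
  exact ((h _ (by linarith)).sub (h _ (by linarith))).sub
    (((h _ (by linarith)).sub (h _ (by linarith))).const_mul _)

lemma hurwitz_eq {x : ℝ} (hx0 : 0 < x) (hx1 : x ≤ 1) {s : ℂ} (hs : 1 < s.re) :
    HurwitzZeta.hurwitzZeta (x : UnitAddCircle) s - HurwitzZeta.hurwitzZeta (0 : UnitAddCircle) s
      = (1 - x) + ∑' n, lerchTerm x n s := by
  have h1 := HurwitzZeta.hasSum_hurwitzZeta_of_one_lt_re (a := x) ⟨hx0.le, hx1⟩ hs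
  have h2 := HurwitzZeta.hasSum_hurwitzZeta_of_one_lt_re (a := 1) ⟨by norm_num, le_refl _⟩ hs
  have e10 : ((1 : ℝ) : UnitAddCircle) = 0 := AddCircle.coe_period 1
  rw [e10] at h2
  have h3 : HasSum (fun n : ℕ => 1 / (((n + 1 : ℕ) : ℂ) + (1 : ℝ)) ^ s)
      (HurwitzZeta.hurwitzZeta (0 : UnitAddCircle) s - 1) := by
    have := (hasSum_nat_add_iff' (f := fun n : ℕ => 1 / ((n : ℂ) + (1 : ℝ)) ^ s) 1).mpr h2
    simpa using this
  have h4 := (h1.sub h2).sub ((h3.sub h2).mul_left ((x : ℂ) - 1))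
  have h5 : HasSum (fun n => lerchTerm x n s) (HurwitzZeta.hurwitzZeta (x : UnitAddCircle) s
      - HurwitzZeta.hurwitzZeta (0 : UnitAddCircle) s - (x - 1) * (-1)) := by
    have hf : ∀ n : ℕ, lerchTerm x n s = 1 / ((n : ℂ) + x) ^ s - 1 / ((n : ℂ) + (1 : ℝ)) ^ s
        - ((x : ℂ) - 1) * (1 / (((n + 1 : ℕ) : ℂ) + (1 : ℝ)) ^ s - 1 / ((n : ℂ) + (1 : ℝ)) ^ s) := by
      intro n
      simp only [lerchTerm, Complex.cpow_neg, one_div]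
      push_cast
      rw [show (n : ℂ) + 1 + 1 = n + 2 by ring]
    rw [funext hf]
    have he : ∀ a b c : ℂ, a - b - (c - 1) * (-1) = a - b - (c - 1) * (b - 1 - b) := by
      intros; ring
    rw [he]
    exact h4
  rw [h5.tsum_eq]; ring

theorem lerch {x : ℝ} (hx0 : 0 < x) (hx1 : x ≤ 1) :
    deriv (HurwitzZeta.hurwitzZeta (x : UnitAddCircle)) 0 =
      deriv riemannZeta 0 + (Real.log (Real.Gamma x) : ℂ) := by
  set U : Set ℂ := {s : ℂ | -(1 / 2 : ℝ) < s.re} ∩ Metric.ball 0 3 with hU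
  have hUo : IsOpen U := (isOpen_lt continuous_const Complex.continuous_re).inter Metric.isOpen_ball
  have hUc : IsPreconnected U :=
    ((convex_halfSpace_re_gt _).inter (convex_ball _ _)).isPreconnected
  have hsum : Summable fun n : ℕ => (24 * x ^ (-(5 : ℝ))) * ((n : ℝ) + 1) ^ (-(3 / 2 : ℝ)) := by
    apply Summable.mul_left
    have := (summable_nat_add_iff 1).mpr (Real.summable_nat_rpow (p := -(3 / 2)) |>.mpr (by norm_num))
    simpa using this
  have hb : ∀ (n : ℕ), ∀ w ∈ U, ‖lerchTerm x n w‖ ≤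
      (24 * x ^ (-(5 : ℝ))) * ((n : ℝ) + 1) ^ (-(3 / 2 : ℝ)) :=
    fun n w hw => lerchTerm_bound hx0 hx1 n hw.1 (by simpa using hw.2)
  have hdt : ∀ n, DifferentiableOn ℂ (lerchTerm x n) U := fun n w _ =>
    (lerchTerm_hasDerivAt hx0 n w).differentiableAt.differentiableWithinAt
  have hd := Complex.differentiableOn_tsum_of_summable_norm hsum hdt hUo hb
  have h0U : (0 : ℂ) ∈ U := ⟨by simp, by simp⟩
  have hder := Complex.hasSum_deriv_of_summable_norm hsum hdt hUo hb h0U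
  have hEq : Set.EqOn (fun s => HurwitzZeta.hurwitzZeta (x : UnitAddCircle) s
      - HurwitzZeta.hurwitzZeta (0 : UnitAddCircle) s)
      (fun s => (1 - x) + ∑' n, lerchTerm x n s) U := by
    apply AnalyticOnNhd.eqOn_of_preconnected_of_eventuallyEq (𝕜 := ℂ) (z₀ := 2) _ _ hUc
    · exact ⟨by norm_num, by simp; norm_num⟩
    · have : {s : ℂ | 1 < s.re} ∈ 𝓝 (2 : ℂ) :=
        (isOpen_lt continuous_const Complex.continuous_re).mem_nhds (by norm_num)
      filter_upwards [this] with s hs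
      exact hurwitz_eq hx0 hx1 hs
    · exact (HurwitzZeta.differentiable_hurwitzZeta_sub_hurwitzZeta _ _).differentiableOn.analyticOnNhd hUo
    · exact ((differentiableOn_const _).add hd).analyticOnNhd hUo
  have hEq' : (fun s => HurwitzZeta.hurwitzZeta (x : UnitAddCircle) s
      - HurwitzZeta.hurwitzZeta (0 : UnitAddCircle) s) =ᶠ[𝓝 0]
      (fun s => (1 - x) + ∑' n, lerchTerm x n s) := by
    filter_upwards [hUo.mem_nhds h0U] with s hs using hEq hs
  have hD := hEq'.deriv_eq
  rw [deriv_const_add, deriv_fun_sub (HurwitzZeta.differentiableAt_hurwitzZeta _ (by norm_num))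
    (HurwitzZeta.differentiableAt_hurwitzZeta _ (by norm_num)), HurwitzZeta.hurwitzZeta_zero] at hD
  rw [← sub_eq_iff_eq_add', hD]
  have ht := hder.tendsto_sum_nat
  have ht2 := (Complex.continuous_ofReal.tendsto _).comp
    (((Real.BohrMollerup.tendsto_log_gamma hx0)))
  refine tendsto_nhds_unique (ht.comp (tendsto_add_atTop_nat 1)) ?_
  -- correction term
  have hcorr : Tendsto (fun n : ℕ => Real.log ((n : ℝ) + 1 + 1) - Real.log n) atTop (𝓝 0) := by
    have h1 : Tendsto (fun n : ℕ => Real.log (1 + 2 / (n : ℝ))) atTop (𝓝 (Real.log (1 + 0))) := by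
      apply ((Real.continuousAt_log (by norm_num)).tendsto).comp
      exact tendsto_const_nhds.add (tendsto_const_div_atTop_nhds_zero_nat 2)
    simp only [add_zero, Real.log_one] at h1
    refine h1.congr' ?_
    filter_upwards [eventually_gt_atTop 0] with n hn
    have hn' : (0 : ℝ) < n := by exact_mod_cast hn
    rw [← Real.log_div (by positivity) (by positivity)]
    congr 1; field_simp; ring
  have hcorr2 : Tendsto (fun n : ℕ => Real.log ((n : ℝ) + 1) - Real.log n) atTop (𝓝 0) := by
    have h1 : Tendsto (fun n : ℕ => Real.log (1 + 1 / (n : ℝ))) atTop (𝓝 (Real.log (1 + 0))) := by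
      apply ((Real.continuousAt_log (by norm_num)).tendsto).comp
      exact tendsto_const_nhds.add (tendsto_const_div_atTop_nhds_zero_nat 1)
    simp only [add_zero, Real.log_one] at h1
    refine h1.congr' ?_
    filter_upwards [eventually_gt_atTop 0] with n hn
    have hn' : (0 : ℝ) < n := by exact_mod_cast hn
    rw [← Real.log_div (by positivity) (by positivity)]
    congr 1; field_simp
  have hreal : Tendsto (fun n : ℕ => Real.BohrMollerup.logGammaSeq x n
      + ((x - 1) * (Real.log ((n : ℝ) + 1 + 1) - Real.log n)
        + (Real.log ((n : ℝ) + 1) - Real.log n))) atTop (𝓝 (Real.log (Real.Gamma x))) := by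
    have := (Real.BohrMollerup.tendsto_log_gamma hx0).add ((hcorr.const_mul (x - 1)).add hcorr2)
    simpa using this
  refine ((Complex.continuous_ofReal.tendsto _).comp hreal).congr fun n => ?_
  simp only [Function.comp_apply]
  have hterm : ∀ k : ℕ, deriv (lerchTerm x k) 0 = ((- Real.log (x + k) + Real.log ((k : ℝ) + 1)
      + (x - 1) * (Real.log ((k : ℝ) + 1 + 1) - Real.log ((k : ℝ) + 1)) : ℝ) : ℂ) := by
    intro k
    have hk : (0 : ℝ) ≤ k := k.cast_nonneg
    rw [(lerchTerm_hasDerivAt hx0 k 0).deriv]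
    simp only [neg_zero, Complex.cpow_zero, one_mul]
    rw [← Complex.ofReal_log (by linarith), ← Complex.ofReal_log (by linarith),
      ← Complex.ofReal_log (by linarith)]
    rw [show (k : ℝ) + 1 + 1 = k + 2 by ring, add_comm x]
    push_cast; ring
  simp only [hterm]
  rw [← Complex.ofReal_sum]
  congr 1
  rw [Finset.sum_add_distrib, Finset.sum_add_distrib, ← Finset.mul_sum]
  have t1 : ∑ k ∈ Finset.range (n + 1), (Real.log ((k : ℝ) + 1 + 1) - Real.log ((k : ℝ) + 1))
      = Real.log ((n : ℝ) + 1 + 1) := by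
    have := Finset.sum_range_sub (fun k : ℕ => Real.log ((k : ℝ) + 1)) (n + 1)
    simpa using this
  have t2 : ∀ m : ℕ, ∑ k ∈ Finset.range m, Real.log ((k : ℝ) + 1) = Real.log (m.factorial) := by
    intro m
    induction m with
    | zero => simp
    | succ m ih =>
      rw [Finset.sum_range_succ, ih, Nat.factorial_succ, Nat.cast_mul, Real.log_mul]
      · push_cast; ring
      · positivity
      · positivity
  rw [t1, t2, Real.BohrMollerup.logGammaSeq, Nat.factorial_succ, Nat.cast_mul,
    Real.log_mul (by positivity) (by positivity)]
  push_cast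
  rw [Finset.sum_neg_distrib]
  ring

end CS
end

section
open Filter Topology

namespace CS

lemma _root_.HasSum.congr_fun' {β : Type*} {f g : β → ℂ} {a : ℂ} (h : HasSum f a)
    (hfg : ∀ b, g b = f b) : HasSum g a := by rwa [funext hfg]

/-- `|mτ+n|²` for `τ = x + iy`, `p = (m,n)`. -/
noncomputable def Q (x y : ℝ) (p : ℤ × ℤ) : ℝ := ((p.2 : ℝ) + p.1 * x) ^ 2 + (p.1 * y) ^ 2

lemma Q_nonneg (x y : ℝ) (p : ℤ × ℤ) : 0 ≤ Q x y p := by unfold Q; positivity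

lemma Q_eq_zero_iff {x y : ℝ} (hy : 0 < y) (p : ℤ × ℤ) : Q x y p = 0 ↔ p = 0 := by
  constructor
  · intro h
    unfold Q at h
    have h1 : ((p.1 : ℝ) * y) ^ 2 = 0 := by nlinarith [sq_nonneg ((p.2 : ℝ) + p.1 * x), sq_nonneg ((p.1 : ℝ) * y)]
    have h2 : (p.1 : ℝ) = 0 := by
      rcases mul_eq_zero.mp (pow_eq_zero_iff (two_ne_zero) |>.mp h1) with h | h
      · exact h
      · exact absurd h hy.ne'
    rw [h2] at h
    simp at h
    have h3 : p.1 = 0 := by exact_mod_cast h2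
    exact Prod.ext h3 h
  · rintro rfl; simp [Q]

lemma Q_eq_normSq (x y : ℝ) (p : ℤ × ℤ) :
    Q x y p = ‖(p.1 : ℂ) * (⟨x, y⟩ : ℂ) + p.2‖ ^ 2 := by
  rw [← Complex.normSq_eq_norm_sq, Complex.normSq_apply]
  simp [Q]; ring

lemma summable_Q {x y : ℝ} (hy : 0 < y) {σ : ℝ} (hσ : 1 < σ) :
    Summable fun p : ℤ × ℤ => (1 : ℝ) / (Q x y p) ^ σ := by
  let z : UpperHalfPlane := ⟨⟨x, y⟩, hy⟩
  have h1 := (EisensteinSeries.summable_one_div_norm_rpow (k := 2 * σ) (by linarith)).mul_left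
    (EisensteinSeries.r z ^ (-(2 * σ)))
  have h2 : Summable fun v : Fin 2 → ℤ => ‖(v 0 : ℂ) * z + v 1‖ ^ (-(2 * σ)) :=
    Summable.of_nonneg_of_le (fun v => by positivity)
      (fun v => EisensteinSeries.summand_bound z (by linarith) v) h1
  rw [← (finTwoArrowEquiv ℤ).symm.summable_iff] at h2
  refine h2.congr fun p => ?_
  simp only [Function.comp_apply, finTwoArrowEquiv_symm_apply, Matrix.cons_val_zero,
    Matrix.cons_val_one]
  rw [Q_eq_normSq, ← Real.rpow_natCast, ← Real.rpow_mul (norm_nonneg _), one_div,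
    ← Real.rpow_neg (norm_nonneg _)]
  rfl

lemma exp_neg_le (a : ℕ) {u : ℝ} (hu : 0 < u) : Real.exp (-u) ≤ a.factorial / u ^ a := by
  rw [Real.exp_neg, ← one_div, div_le_div_iff₀ (Real.exp_pos _) (by positivity), one_mul]
  have := Real.pow_div_factorial_le_exp u hu.le a
  rw [div_le_iff₀ (by positivity)] at this
  linarith

/-- The doubly-nonconstant theta term. -/
noncomputable def phi (x y : ℝ) (p : ℤ × ℤ) (t : ℝ) : ℂ :=
  if p.1 = 0 ∨ p.2 = 0 then 0 else
    (Real.exp (-(Real.pi * (p.1 * y) ^ 2 * t)) * Real.exp (-(Real.pi * (p.2 : ℝ) ^ 2 / t)) : ℝ) *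
      Complex.exp (2 * Real.pi * Complex.I * (p.1 * x : ℝ) * p.2)

lemma norm_unit_exp (r : ℝ) (k : ℤ) :
    ‖Complex.exp (2 * Real.pi * Complex.I * r * k)‖ = 1 := by
  rw [show (2 * Real.pi * Complex.I * r * k : ℂ) = ((2 * Real.pi * r * k : ℝ) : ℂ) * Complex.I by
    push_cast; ring]
  exact Complex.norm_exp_ofReal_mul_I _

noncomputable def phiC (y : ℝ) (a b : ℕ) : ℝ :=
  a.factorial / (Real.pi * y ^ 2) ^ a * (b.factorial / Real.pi ^ b)

lemma phi_bound {x y : ℝ} (hy : 0 < y) (a b : ℕ) (p : ℤ × ℤ) {t : ℝ} (ht : 0 < t) :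
    ‖phi x y p t‖ ≤ (phiC y a b * (t ^ b / t ^ a)) *
      ((1 / |(p.1 : ℝ)| ^ (2 * a)) * (1 / |(p.2 : ℝ)| ^ (2 * b))) := by
  unfold phi
  have hpi := Real.pi_pos
  split_ifs with h
  · rw [norm_zero]; unfold phiC; positivity
  · push Not at h
    obtain ⟨h1, h2⟩ := h
    have h1' : (p.1 : ℝ) ≠ 0 := by exact_mod_cast h1
    have h2' : (p.2 : ℝ) ≠ 0 := by exact_mod_cast h2
    rw [norm_mul, norm_unit_exp, mul_one, Complex.norm_real, Real.norm_of_nonneg (by positivity)]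
    have e1 := exp_neg_le a (u := Real.pi * (p.1 * y) ^ 2 * t) (by positivity)
    have e2 := exp_neg_le b (u := Real.pi * (p.2 : ℝ) ^ 2 / t) (by positivity)
    calc _ ≤ _ := mul_le_mul e1 e2 (by positivity) (by positivity)
      _ = _ := by
        unfold phiC
        rw [pow_mul, pow_mul, sq_abs, sq_abs]
        have q1 : ((p.1 : ℝ) ^ 2) ≠ 0 := by positivity
        have q2 : ((p.2 : ℝ) ^ 2) ≠ 0 := by positivity
        rw [mul_pow (p.1 : ℝ)]
        simp only [mul_pow, div_pow]
        field_simp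

lemma summable_pq {a b : ℕ} (ha : 1 ≤ a) (hb : 1 ≤ b) : Summable fun p : ℤ × ℤ =>
    ((1 / |(p.1 : ℝ)| ^ (2 * a)) * (1 / |(p.2 : ℝ)| ^ (2 * b))) := by
  have h : ∀ c : ℕ, 1 ≤ c → Summable fun m : ℤ => 1 / |(m : ℝ)| ^ (2 * c) := by
    intro c hc
    have := Real.summable_one_div_int_pow (p := 2 * c) |>.mpr (by omega)
    refine this.congr fun m => ?_
    rw [pow_mul, pow_mul, sq_abs]
  exact (h a ha).mul_of_nonneg (h b hb) (fun _ => by positivity) (fun _ => by positivity)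

lemma phi_summable {x y : ℝ} (hy : 0 < y) {t : ℝ} (ht : 0 < t) :
    Summable fun p => phi x y p t :=
  Summable.of_norm_bounded ((summable_pq le_rfl le_rfl).mul_left _)
    (fun p => phi_bound hy 1 1 p ht)

noncomputable def Phi (x y t : ℝ) : ℂ := ∑' p, phi x y p t

lemma Phi_bound {x y : ℝ} (hy : 0 < y) {a b : ℕ} (ha : 1 ≤ a) (hb : 1 ≤ b) : ∃ C : ℝ, ∀ t, 0 < t →
    ‖Phi x y t‖ ≤ C * (t ^ b / t ^ a) := by
  refine ⟨phiC y a b * ∑' p : ℤ × ℤ, ((1 / |(p.1 : ℝ)| ^ (2 * a)) * (1 / |(p.2 : ℝ)| ^ (2 * b))),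
    fun t ht => ?_⟩
  have := tsum_of_norm_bounded (f := fun p => phi x y p t)
    ((summable_pq ha hb).mul_left (phiC y a b * (t ^ b / t ^ a))).hasSum
    (fun p => phi_bound hy a b p ht)
  rw [tsum_mul_left] at this
  unfold Phi
  linarith

lemma phi_continuousOn (x y : ℝ) (p : ℤ × ℤ) : ContinuousOn (phi x y p) (Set.Ioi 0) := by
  unfold phi
  split_ifs
  · exact continuousOn_const
  · refine ContinuousOn.mul ?_ continuousOn_const
    refine Complex.continuous_ofReal.comp_continuousOn ?_
    refine ContinuousOn.mul (by fun_prop) ?_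
    refine Real.continuous_exp.comp_continuousOn ?_
    refine ContinuousOn.neg (ContinuousOn.div continuousOn_const continuousOn_id ?_)
    intro t ht; exact (Set.mem_Ioi.mp ht).ne'

lemma Phi_continuousOn {x y : ℝ} (hy : 0 < y) : ContinuousOn (Phi x y) (Set.Ioi 0) := by
  unfold Phi
  refine continuousOn_tsum (fun p => phi_continuousOn x y p)
    ((summable_pq le_rfl le_rfl).mul_left (phiC y 1 1)) ?_
  intro p t ht
  have ht' : (0 : ℝ) < t := ht
  have := phi_bound (x := x) hy 1 1 p ht'
  rwa [div_self (by positivity), mul_one] at this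

lemma Phi_top {x y : ℝ} (hy : 0 < y) (N : ℕ) :
    Phi x y =O[atTop] fun t => t ^ (-(N : ℝ)) := by
  obtain ⟨C, hC⟩ := Phi_bound (x := x) hy (a := N + 1) (b := 1) (by omega) le_rfl
  refine Asymptotics.IsBigO.of_bound C ?_
  filter_upwards [eventually_gt_atTop 0] with t ht
  refine (hC t ht).trans (le_of_eq ?_)
  rw [Real.norm_of_nonneg (by positivity), Real.rpow_neg ht.le, Real.rpow_natCast]
  field_simp
  ring

lemma Phi_zero {x y : ℝ} (hy : 0 < y) (N : ℕ) :
    Phi x y =O[𝓝[>] 0] fun t => t ^ (-(-(N : ℝ))) := by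
  obtain ⟨C, hC⟩ := Phi_bound (x := x) hy (a := 1) (b := N + 1) le_rfl (by omega)
  refine Asymptotics.IsBigO.of_bound C ?_
  filter_upwards [self_mem_nhdsWithin] with t ht
  have ht : (0 : ℝ) < t := ht
  refine (hC t ht).trans (le_of_eq ?_)
  rw [neg_neg, Real.norm_of_nonneg (by positivity), Real.rpow_natCast]
  field_simp
  ring

lemma Phi_mellinConvergent {x y : ℝ} (hy : 0 < y) (s : ℂ) : MellinConvergent (Phi x y) s := by
  obtain ⟨N, hN⟩ := exists_nat_gt |s.re|
  have := abs_lt.mp hN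
  exact mellinConvergent_of_isBigO_rpow
    ((Phi_continuousOn hy).locallyIntegrableOn measurableSet_Ioi)
    (Phi_top hy N) this.2 (Phi_zero hy N) this.1

lemma Phi_mellin_differentiable {x y : ℝ} (hy : 0 < y) : Differentiable ℂ (mellin (Phi x y)) := by
  intro s
  obtain ⟨N, hN⟩ := exists_nat_gt |s.re|
  have := abs_lt.mp hN
  exact mellin_differentiableAt_of_isBigO_rpow
    ((Phi_continuousOn hy).locallyIntegrableOn measurableSet_Ioi)
    (Phi_top hy N) this.2 (Phi_zero hy N) this.1

/-! ### The theta identity -/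

lemma hasSum_theta {x y : ℝ} (hy : 0 < y) {t : ℝ} (ht : 0 < t) :
    HasSum (fun p : ℤ × ℤ => if Q x y p = 0 then (0 : ℂ) else
      1 * (Real.exp (-Real.pi * Q x y p * t) : ℂ))
      (((HurwitzZeta.evenKernel 0 t : ℂ) - 1) + (t : ℂ) ^ (-(1 / 2) : ℂ) •
        (((HurwitzZeta.evenKernel 0 (y ^ 2 * t) : ℂ) - 1) + Phi x y t)) := by
  have hpi := Real.pi_pos
  set f : ℤ × ℤ → ℂ := fun p => if Q x y p = 0 then (0 : ℂ) else
      1 * (Real.exp (-Real.pi * Q x y p * t) : ℂ) with hf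
  have hsum : Summable f := by
    refine Summable.of_norm_bounded (g := fun p => (2 / (Real.pi * t) ^ 2) * (1 / Q x y p ^ (2 : ℝ)))
      ((summable_Q hy (by norm_num)).mul_left _) ?_
    intro p
    simp only [hf]
    split_ifs with h
    · simp only [norm_zero, h]; positivity
    · have hq : 0 < Q x y p := lt_of_le_of_ne (Q_nonneg x y p) (Ne.symm h)
      rw [one_mul, Complex.norm_real, Real.norm_of_nonneg (by positivity)]
      have := exp_neg_le 2 (u := Real.pi * Q x y p * t) (by positivity)
      rw [show -Real.pi * Q x y p * t = -(Real.pi * Q x y p * t) by ring]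
      refine this.trans (le_of_eq ?_)
      rw [show ((2 : ℝ)) = ((2 : ℕ) : ℝ) by norm_num, Real.rpow_natCast]
      simp [Nat.factorial]
      field_simp
  have hpow : (t : ℂ) ^ (-(1 / 2) : ℂ) = ((1 / t ^ (1 / 2 : ℝ) : ℝ) : ℂ) := by
    rw [one_div (t ^ (1 / 2 : ℝ)), ← Real.rpow_neg ht.le, Complex.ofReal_cpow ht.le]
    push_cast; rfl
  set r : ℂ := (t : ℂ) ^ (-(1 / 2) : ℂ) with hr
  -- inner sums
  let g : ℤ → ℂ := fun m => if m = 0 then ((HurwitzZeta.evenKernel 0 t : ℂ) - 1) else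
    r * (Real.exp (-Real.pi * (m : ℝ) ^ 2 * (y ^ 2 * t)) + ∑' k, phi x y (m, k) t)
  have hinner : ∀ m : ℤ, HasSum (fun n => f (m, n)) (g m) := by
    intro m
    have he := HurwitzZeta.hasSum_int_evenKernel (m * x) ht
    by_cases hm : m = 0
    · subst hm
      simp only [g, if_true]
      have he' : HasSum (fun n : ℤ => (Real.exp (-Real.pi * (n : ℝ) ^ 2 * t) : ℂ))
          (HurwitzZeta.evenKernel 0 t : ℂ) := by
        have := Complex.hasSum_ofReal.mpr he
        simpa using this
      have h2 := he'.sub (hasSum_ite_eq (0 : ℤ) (1 : ℂ))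
      refine h2.congr_fun' ?_
      intro n
      simp only [hf, Q_eq_zero_iff hy]
      by_cases hn : n = 0
      · subst hn; simp
      · simp [hn, Q]
    · simp only [g, if_neg hm]
      have hf' : ∀ n : ℤ, f (m, n) = (Real.exp (-Real.pi * (m : ℝ) ^ 2 * (y ^ 2 * t)) : ℂ) *
          (Real.exp (-Real.pi * ((n : ℝ) + m * x) ^ 2 * t) : ℂ) := by
        intro n
        simp only [hf, Q_eq_zero_iff hy]
        rw [if_neg (by simp [hm]), one_mul, ← Complex.ofReal_mul, ← Real.exp_add]
        congr 2
        simp only [Q]; ring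
      rw [funext hf']
      have h1 := (Complex.hasSum_ofReal.mpr he).mul_left
        (Real.exp (-Real.pi * (m : ℝ) ^ 2 * (y ^ 2 * t)) : ℂ)
      have hval : (Real.exp (-Real.pi * (m : ℝ) ^ 2 * (y ^ 2 * t)) : ℂ) *
          (HurwitzZeta.evenKernel ((m * x : ℝ) : UnitAddCircle) t : ℂ) =
          r * (Real.exp (-Real.pi * (m : ℝ) ^ 2 * (y ^ 2 * t)) + ∑' k, phi x y (m, k) t) := by
        rw [HurwitzZeta.evenKernel_functional_equation, Complex.ofReal_mul, ← hpow, mul_left_comm]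
        congr 1
        have hc := (HurwitzZeta.hasSum_int_cosKernel (m * x) (t := 1 / t) (by positivity)).mul_left
          (Real.exp (-Real.pi * (m : ℝ) ^ 2 * (y ^ 2 * t)) : ℂ)
        have hc2 := hc.sub (hasSum_ite_eq (0 : ℤ)
          (Real.exp (-Real.pi * (m : ℝ) ^ 2 * (y ^ 2 * t)) : ℂ))
        have hc3 : HasSum (fun k => phi x y (m, k) t) _ := hc2.congr_fun' (by
          intro k
          by_cases hk : k = 0
          · subst hk; simp [phi]
          · simp only [phi, hm, hk, or_self, if_false, sub_zero]
            rw [Complex.ofReal_mul, mul_comm (Complex.exp _), ← mul_assoc]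
            congr 3
            · ring_nf
            · ring_nf)
        rw [hc3.tsum_eq]; ring
      rw [← hval]; exact h1
  have hHS : HasSum f (∑' p, f p) := hsum.hasSum
  have hg := hHS.prod_fiberwise hinner
  -- compute the sum of g differently
  have hphi := (phi_summable (x := x) hy ht).hasSum
  have hphi2 := hphi.prod_fiberwise (fun m => ((phi_summable (x := x) hy ht).prod_factor m).hasSum)
  have hev : HasSum (fun m : ℤ => (Real.exp (-Real.pi * (m : ℝ) ^ 2 * (y ^ 2 * t)) : ℂ)
      - if m = 0 then 1 else 0)
      ((HurwitzZeta.evenKernel 0 (y ^ 2 * t) : ℂ) - 1) := by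
    have := Complex.hasSum_ofReal.mpr
      (HurwitzZeta.hasSum_int_evenKernel 0 (t := y ^ 2 * t) (by positivity))
    simp only [add_zero, AddCircle.coe_zero] at this
    exact this.sub (hasSum_ite_eq (0 : ℤ) (1 : ℂ))
  have htot := (hasSum_ite_eq (0 : ℤ) ((HurwitzZeta.evenKernel 0 t : ℂ) - 1)).add
    ((hev.add hphi2).mul_left r)
  have hg2 : HasSum g _ := htot.congr_fun' (by
    intro m
    by_cases hm : m = 0
    · subst hm; simp [g, phi]
    · simp [g, hm])
  have := hg.unique hg2
  rw [this] at hHS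
  exact hHS

end CS
end

section
open Filter Topology

namespace CS

lemma hasMellin_evenKernel {s : ℂ} (hs : 1 / 2 < s.re) :
    HasMellin (fun t => (HurwitzZeta.evenKernel 0 t : ℂ) - 1) s (2 * completedRiemannZeta (2 * s)) := by
  have h := (HurwitzZeta.hurwitzEvenFEPair 0).hasMellin (s := s) hs
  have h2 : completedRiemannZeta (2 * s) = (HurwitzZeta.hurwitzEvenFEPair 0).Λ s / 2 := by
    rw [← HurwitzZeta.completedHurwitzZetaEven_zero, HurwitzZeta.completedHurwitzZetaEven]
    congr 2; ring
  rw [h2, mul_div_cancel₀ _ two_ne_zero]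
  have h3 : (HurwitzZeta.hurwitzEvenFEPair 0).f₀ = 1 := by simp [HurwitzZeta.hurwitzEvenFEPair]
  rw [h3] at h
  exact h

lemma epstein_mellin {x y : ℝ} (hy : 0 < y) {s : ℂ} (hs : 1 < s.re) :
    HasSum (fun p => (Real.pi : ℂ) ^ (-s) * Complex.Gamma s * 1 / (Q x y p : ℂ) ^ s)
      (2 * completedRiemannZeta (2 * s) + (((y ^ 2 : ℝ) : ℂ) ^ (-(s - 1 / 2)) *
        (2 * completedRiemannZeta (2 * (s - 1 / 2))) + mellin (Phi x y) (s - 1 / 2))) := by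
  have h1 := hasSum_mellin_pi_mul₀ (a := fun _ : ℤ × ℤ => (1 : ℂ)) (p := Q x y) (s := s)
    (Q_nonneg x y) (by linarith) (fun t ht => hasSum_theta hy ht)
    (by simpa using summable_Q (x := x) hy hs)
  have ha := hasMellin_evenKernel (s := s) (by linarith)
  have hb0 := hasMellin_evenKernel (s := s - 1 / 2) (by simp; linarith)
  have hb1 := (MellinConvergent.comp_mul_left (a := y ^ 2) (by positivity)).mpr hb0.1
  have hb2 := mellin_comp_mul_left (fun t => (HurwitzZeta.evenKernel 0 t : ℂ) - 1) (s - 1 / 2)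
    (a := y ^ 2) (by positivity)
  rw [hb0.2] at hb2
  have hc := Phi_mellinConvergent (x := x) hy (s - 1 / 2)
  have hbc := hasMellin_add hb1 hc
  have hbc1 := hbc.1
  rw [sub_eq_add_neg s (1 / 2), ← MellinConvergent.cpow_smul] at hbc1
  have hbc2 := mellin_cpow_smul (fun t => ((HurwitzZeta.evenKernel 0 (y ^ 2 * t) : ℂ) - 1) + Phi x y t)
    s (-(1 / 2))
  rw [← sub_eq_add_neg s (1 / 2), hbc.2, hb2] at hbc2
  have htot := hasMellin_add ha.1 hbc1
  rw [htot.2, ha.2, hbc2] at h1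
  exact h1

/-- The meromorphic continuation of `∑' (|mτ+n|²/y)^{-s}`. -/
noncomputable def Ep (x y : ℝ) (s : ℂ) : ℂ :=
  (y : ℂ) ^ s * (2 * riemannZeta (2 * s) + (Real.pi : ℂ) ^ s * (Complex.Gamma s)⁻¹ *
    (((y ^ 2 : ℝ) : ℂ) ^ (-(s - 1 / 2)) *
        (2 * completedRiemannZeta (2 * s - 1)) + mellin (Phi x y) (s - 1 / 2)))

lemma Ep_hasSum {x y : ℝ} (hy : 0 < y) {s : ℂ} (hs : 1 < s.re) :
    HasSum (fun p => (y : ℂ) ^ s * (1 / (Q x y p : ℂ) ^ s)) (Ep x y s) := by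
  have hs0 : s ≠ 0 := by rintro rfl; simp at hs; linarith
  have h := (epstein_mellin (x := x) hy hs).mul_left
    ((y : ℂ) ^ s * ((Real.pi : ℂ) ^ s * (Complex.Gamma s)⁻¹))
  have hpi : (Real.pi : ℂ) ≠ 0 := by exact_mod_cast Real.pi_pos.ne'
  have hG : Complex.Gamma s ≠ 0 := Complex.Gamma_ne_zero_of_re_pos (by linarith)
  have hpp : (Real.pi : ℂ) ^ s ≠ 0 := by simp [Complex.cpow_eq_zero_iff, hpi]
  have e : Ep x y s = ((y : ℂ) ^ s * ((Real.pi : ℂ) ^ s * (Complex.Gamma s)⁻¹)) *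
      (2 * completedRiemannZeta (2 * s) + (((y ^ 2 : ℝ) : ℂ) ^ (-(s - 1 / 2)) *
        (2 * completedRiemannZeta (2 * (s - 1 / 2))) + mellin (Phi x y) (s - 1 / 2))) := by
    rw [Ep, riemannZeta_def_of_ne_zero (mul_ne_zero two_ne_zero hs0), Complex.Gammaℝ_def]
    rw [show -(2 * s) / 2 = -s by ring, show 2 * s / 2 = s by ring, show 2 * s - 1 = 2 * (s - 1/2) by ring,
      Complex.cpow_neg]
    field_simp
  rw [e]
  refine h.congr_fun' fun p => ?_
  rw [Complex.cpow_neg]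
  field_simp

lemma EpA_differentiableAt {x y : ℝ} (hy : 0 < y) {s : ℂ} (h1 : s ≠ 1 / 2) (h2 : s ≠ 1) :
    DifferentiableAt ℂ (fun s : ℂ => (((y ^ 2 : ℝ) : ℂ) ^ (-(s - 1 / 2)) *
      (2 * completedRiemannZeta (2 * s - 1)) + mellin (Phi x y) (s - 1 / 2))) s := by
  have hy2 : ((y ^ 2 : ℝ) : ℂ) ≠ 0 := by exact_mod_cast (by positivity : (y ^ 2 : ℝ) ≠ 0)
  have hM : DifferentiableAt ℂ (fun s => mellin (Phi x y) (s - 1 / 2)) s :=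
    (Phi_mellin_differentiable (x := x) hy _).comp s (by fun_prop)
  have hyp : DifferentiableAt ℂ (fun s => ((y ^ 2 : ℝ) : ℂ) ^ (-(s - 1 / 2))) s :=
    DifferentiableAt.const_cpow (by fun_prop) (Or.inl hy2)
  have hL : DifferentiableAt ℂ (fun s => 2 * completedRiemannZeta (2 * s - 1)) s := by
    refine DifferentiableAt.const_mul ?_ _
    refine (differentiableAt_completedZeta (s := 2 * s - 1) ?_ ?_).comp s (by fun_prop)
    · intro h; apply h1; linear_combination h / 2
    · intro h; apply h2; linear_combination h / 2
  exact (hyp.mul hL).add hM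

lemma Ep_differentiableAt {x y : ℝ} (hy : 0 < y) {s : ℂ} (h1 : s ≠ 1 / 2) (h2 : s ≠ 1) :
    DifferentiableAt ℂ (Ep x y) s := by
  have hy' : (y : ℂ) ≠ 0 := by exact_mod_cast hy.ne'
  have hy2 : ((y ^ 2 : ℝ) : ℂ) ≠ 0 := by exact_mod_cast (by positivity : (y ^ 2 : ℝ) ≠ 0)
  have hpi : (Real.pi : ℂ) ≠ 0 := by exact_mod_cast Real.pi_pos.ne'
  have hz : DifferentiableAt ℂ (fun s => riemannZeta (2 * s)) s :=
    (differentiableAt_riemannZeta (s := 2 * s) (by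
      intro h; apply h1; linear_combination h / 2)).comp s (by fun_prop)
  have hc : DifferentiableAt ℂ (fun s => (Real.pi : ℂ) ^ s * (Complex.Gamma s)⁻¹ *
      (((y ^ 2 : ℝ) : ℂ) ^ (-(s - 1 / 2)) * (2 * completedRiemannZeta (2 * s - 1)) +
        mellin (Phi x y) (s - 1 / 2))) s := by
    have hG := Complex.differentiable_one_div_Gamma s
    have hp : DifferentiableAt ℂ (fun s => (Real.pi : ℂ) ^ s) s :=
      DifferentiableAt.const_cpow differentiableAt_id (Or.inl hpi)
    exact (hp.mul hG).mul (EpA_differentiableAt hy h1 h2)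
  exact (DifferentiableAt.const_cpow differentiableAt_id (Or.inl hy')).mul ((hz.const_mul 2).add hc)

lemma completedZeta_neg_one : completedRiemannZeta (-1) = Real.pi / 6 := by
  have h := completedRiemannZeta_one_sub 2
  have h2 := riemannZeta_def_of_ne_zero (s := 2) two_ne_zero
  rw [riemannZeta_two] at h2
  rw [show (-1 : ℂ) = 1 - 2 by norm_num, h]
  have hG : Complex.Gammaℝ 2 = (Real.pi : ℂ)⁻¹ := by
    rw [Complex.Gammaℝ_def]
    norm_num [Complex.cpow_neg_one]
  have hpi : (Real.pi : ℂ) ≠ 0 := by exact_mod_cast Real.pi_pos.ne'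
  rw [hG] at h2
  field_simp at h2
  linear_combination -h2/6

/-- Kronecker limit data at `0`. -/
lemma Ep_hasDerivAt {x y : ℝ} (hy : 0 < y) :
    Ep x y 0 = -1 ∧ HasDerivAt (Ep x y) (-(Real.log y : ℂ) + 4 * deriv riemannZeta 0 +
      (y * Real.pi / 3 + mellin (Phi x y) (-1 / 2))) 0 := by
  have hy' : (y : ℂ) ≠ 0 := by exact_mod_cast hy.ne'
  have hy2 : ((y ^ 2 : ℝ) : ℂ) ≠ 0 := by exact_mod_cast (by positivity : (y ^ 2 : ℝ) ≠ 0)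
  have hpi : (Real.pi : ℂ) ≠ 0 := by exact_mod_cast Real.pi_pos.ne'
  let A : ℂ → ℂ := fun s => (((y ^ 2 : ℝ) : ℂ) ^ (-(s - 1 / 2)) *
        (2 * completedRiemannZeta (2 * s - 1)) + mellin (Phi x y) (s - 1 / 2))
  have hA : DifferentiableAt ℂ A 0 := EpA_differentiableAt hy (by norm_num) (by norm_num)
  have hA0 : A 0 = y * Real.pi / 3 + mellin (Phi x y) (-1 / 2) := by
    simp only [A]
    have : ((y ^ 2 : ℝ) : ℂ) ^ (-(0 - 1 / 2) : ℂ) = y := by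
      rw [show (-(0 - 1 / 2) : ℂ) = ((1 / 2 : ℝ) : ℂ) by push_cast; ring,
        ← Complex.ofReal_cpow (by positivity), ← Real.sqrt_eq_rpow, Real.sqrt_sq hy.le]
    rw [this, show (2 * 0 - 1 : ℂ) = -1 by norm_num, completedZeta_neg_one,
      show (0 - 1 / 2 : ℂ) = -1 / 2 by norm_num]
    ring
  have hGi : HasDerivAt (fun s => (Complex.Gamma s)⁻¹) 1 0 := by
    have e : (fun s => (Complex.Gamma s)⁻¹) = fun s => s * (Complex.Gamma (s + 1))⁻¹ := by
      ext s; exact Complex.one_div_Gamma_eq_self_mul_one_div_Gamma_add_one s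
    rw [e]
    have h1 : DifferentiableAt ℂ (fun s => (Complex.Gamma (s + 1))⁻¹) 0 :=
      (Complex.differentiable_one_div_Gamma (0 + 1)).comp (0 : ℂ) (f := fun s : ℂ => s + 1) (by fun_prop)
    have := (hasDerivAt_id (0 : ℂ)).mul h1.hasDerivAt
    simpa using! this
  have hp : HasDerivAt (fun s : ℂ => (Real.pi : ℂ) ^ s) (Complex.log Real.pi) 0 := by
    have := (hasDerivAt_id (0 : ℂ)).const_cpow (c := (Real.pi : ℂ)) (Or.inl hpi)
    simpa using! this
  have hyd : HasDerivAt (fun s : ℂ => (y : ℂ) ^ s) (Complex.log y) 0 := by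
    have := (hasDerivAt_id (0 : ℂ)).const_cpow (c := (y : ℂ)) (Or.inl hy')
    simpa using! this
  have hz : HasDerivAt (fun s : ℂ => riemannZeta (2 * s)) (deriv riemannZeta 0 * 2) 0 := by
    have h1 : HasDerivAt riemannZeta (deriv riemannZeta 0) (2 * 0) := by
      rw [mul_zero]
      exact (differentiableAt_riemannZeta (s := 0) (by norm_num)).hasDerivAt
    have h2 : HasDerivAt (fun s : ℂ => 2 * s) 2 0 := by
      simpa using! (hasDerivAt_id (0 : ℂ)).const_mul 2
    exact HasDerivAt.comp (0 : ℂ) h1 h2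
  have htot := hyd.mul ((hz.const_mul 2).add ((hp.mul hGi).mul hA.hasDerivAt))
  constructor
  · simp [Ep, riemannZeta_zero]; norm_num
  · refine HasDerivAt.congr_deriv (f := Ep x y) htot ?_
    simp [riemannZeta_zero, Complex.Gamma_zero]
    rw [hA0, Complex.ofReal_log hy.le]
    ring

end CS
end

section
open Filter Topology MeasureTheory

namespace CS

noncomputable def GG (u : ℝ) : ℝ := ∫ v in (0 : ℝ)..u, Real.exp (-Real.pi * v ^ 2)

lemma GG_hasDerivAt (u : ℝ) : HasDerivAt GG (Real.exp (-Real.pi * u ^ 2)) u := by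
  have hc : Continuous fun v : ℝ => Real.exp (-Real.pi * v ^ 2) := by fun_prop
  exact intervalIntegral.integral_hasDerivAt_right (hc.intervalIntegrable _ _)
    (hc.stronglyMeasurableAtFilter _ _) hc.continuousAt

lemma GG_neg (u : ℝ) : GG (-u) = -GG u := by
  unfold GG
  have := intervalIntegral.integral_comp_neg (a := 0) (b := u) (fun v : ℝ => Real.exp (-Real.pi * v ^ 2))
  simp only [neg_zero, neg_sq] at this
  rw [this, intervalIntegral.integral_symm]
  

lemma GG_top : Tendsto GG atTop (𝓝 (1 / 2)) := by
  have h := intervalIntegral_tendsto_integral_Ioi (f := fun v : ℝ => Real.exp (-Real.pi * v ^ 2))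
    (b := id) (l := atTop) 0 (integrable_exp_neg_mul_sq Real.pi_pos).integrableOn tendsto_id
  rw [integral_gaussian_Ioi, div_self Real.pi_pos.ne', Real.sqrt_one] at h
  exact h

lemma GG_bot : Tendsto GG atBot (𝓝 (-(1 / 2))) := by
  have h := (GG_top.comp tendsto_neg_atBot_atTop).neg
  refine h.congr fun u => ?_
  simp [GG_neg]

/-- antiderivative of `t^{-3/2} exp(-πA²t - πB²/t)` -/
noncomputable def BF (A B t : ℝ) : ℝ :=
  (Real.exp (-(2 * Real.pi * A * B)) * GG (A * √t - B / √t) +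
    Real.exp (2 * Real.pi * A * B) * GG (-(A * √t + B / √t))) / B

lemma BF_hasDerivAt {A B t : ℝ} (hB : 0 < B) (ht : 0 < t) :
    HasDerivAt (BF A B) (1 / (t * √t) * (Real.exp (-(Real.pi * A ^ 2 * t)) *
      Real.exp (-(Real.pi * B ^ 2 / t)))) t := by
  have hs : 0 < √t := Real.sqrt_pos.mpr ht
  have hss : √t * √t = t := Real.mul_self_sqrt ht.le
  have h0 : HasDerivAt (fun t => √t) (1 / (2 * √t)) t := Real.hasDerivAt_sqrt ht.ne'
  have h1 : HasDerivAt (fun t => B / √t) (-(B * (1 / (2 * √t))) / (√t) ^ 2) t := by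
    have := (hasDerivAt_const t B).div h0 hs.ne'
    simpa using! this
  have e1 := (GG_hasDerivAt (A * √t - B / √t)).comp t ((h0.const_mul A).sub h1)
  have e2 := (GG_hasDerivAt (-(A * √t + B / √t))).comp t ((h0.const_mul A).add h1).neg
  have e := ((e1.const_mul (Real.exp (-(2 * Real.pi * A * B)))).add
    (e2.const_mul (Real.exp (2 * Real.pi * A * B)))).div_const B
  refine HasDerivAt.congr_deriv (f := BF A B) e ?_
  rw [← mul_assoc, ← mul_assoc, ← Real.exp_add, ← Real.exp_add, ← Real.exp_add]
  have E1 : -(2 * Real.pi * A * B) + -Real.pi * (A * √t - B / √t) ^ 2 =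
      -(Real.pi * A ^ 2 * t) + -(Real.pi * B ^ 2 / t) := by
    conv_rhs => rw [← hss]
    field_simp
    ring
  have E2 : (2 * Real.pi * A * B) + -Real.pi * (-(A * √t + B / √t)) ^ 2 =
      -(Real.pi * A ^ 2 * t) + -(Real.pi * B ^ 2 / t) := by
    conv_rhs => rw [← hss]
    field_simp
    ring
  rw [E1, E2]
  have : t * √t = √t ^ 3 := by rw [pow_succ, sq, hss]
  rw [this]
  field_simp
  ring

lemma sqrt_tendsto_zero : Tendsto (fun t : ℝ => √t) (𝓝[>] 0) (𝓝[>] 0) := by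
  refine tendsto_nhdsWithin_iff.mpr ⟨?_, ?_⟩
  · have := Real.continuous_sqrt.tendsto 0
    rw [Real.sqrt_zero] at this
    exact this.mono_left nhdsWithin_le_nhds
  · filter_upwards [self_mem_nhdsWithin] with t ht
    exact Real.sqrt_pos.mpr ht

lemma BF_zero {A B : ℝ} (hB : 0 < B) : Tendsto (BF A B) (𝓝[>] 0)
    (𝓝 ((Real.exp (-(2 * Real.pi * A * B)) * (-(1/2)) + Real.exp (2 * Real.pi * A * B) * (-(1/2))) / B)) := by
  have h1 : Tendsto (fun t : ℝ => B / √t) (𝓝[>] 0) atTop := by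
    simp only [div_eq_mul_inv]
    exact (tendsto_inv_nhdsGT_zero.comp sqrt_tendsto_zero).const_mul_atTop hB
  have h2 : Tendsto (fun t : ℝ => A * √t) (𝓝[>] 0) (𝓝 (A * 0)) :=
    (sqrt_tendsto_zero.mono_right nhdsWithin_le_nhds).const_mul A
  have h3 : Tendsto (fun t : ℝ => A * √t - B / √t) (𝓝[>] 0) atBot := by
    simp only [sub_eq_add_neg]
    exact h2.add_atBot (tendsto_neg_atTop_atBot.comp h1)
  have h4 : Tendsto (fun t : ℝ => -(A * √t + B / √t)) (𝓝[>] 0) atBot :=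
    tendsto_neg_atTop_atBot.comp (h2.add_atTop h1)
  exact (((GG_bot.comp h3).const_mul _).add ((GG_bot.comp h4).const_mul _)).div_const B

lemma BF_top {A B : ℝ} (hA : 0 < A) : Tendsto (BF A B) atTop
    (𝓝 ((Real.exp (-(2 * Real.pi * A * B)) * (1/2) + Real.exp (2 * Real.pi * A * B) * (-(1/2))) / B)) := by
  have h0 : Tendsto (fun t : ℝ => √t) atTop atTop := Real.tendsto_sqrt_atTop
  have h1 : Tendsto (fun t : ℝ => B / √t) atTop (𝓝 0) := h0.const_div_atTop B
  have h2 : Tendsto (fun t : ℝ => A * √t) atTop atTop := h0.const_mul_atTop hA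
  have h3 : Tendsto (fun t : ℝ => A * √t - B / √t) atTop atTop := by
    simp only [sub_eq_add_neg]
    exact h2.atTop_add h1.neg
  have h4 : Tendsto (fun t : ℝ => -(A * √t + B / √t)) atTop atBot :=
    tendsto_neg_atTop_atBot.comp (h2.atTop_add h1)
  exact (((GG_top.comp h3).const_mul _).add ((GG_bot.comp h4).const_mul _)).div_const B

lemma bessel_half {A B : ℝ} (hA : 0 < A) (hB : 0 < B) :
    IntegrableOn (fun t => 1 / (t * √t) * (Real.exp (-(Real.pi * A ^ 2 * t)) *
      Real.exp (-(Real.pi * B ^ 2 / t)))) (Set.Ioi 0) ∧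
    ∫ t in Set.Ioi (0 : ℝ), 1 / (t * √t) * (Real.exp (-(Real.pi * A ^ 2 * t)) *
      Real.exp (-(Real.pi * B ^ 2 / t))) = Real.exp (-(2 * Real.pi * A * B)) / B := by
  set c := ((Real.exp (-(2 * Real.pi * A * B)) * (-(1/2)) + Real.exp (2 * Real.pi * A * B) * (-(1/2))) / B)
    with hc
  let g := Function.update (BF A B) 0 c
  have hg : ContinuousWithinAt g (Set.Ici 0) 0 := by
    rw [continuousWithinAt_update_same]
    have : Set.Ici (0 : ℝ) \ {0} = Set.Ioi 0 := by ext t; simp [lt_iff_le_and_ne, eq_comm]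
    rw [this]
    exact BF_zero hB
  have hd : ∀ t ∈ Set.Ioi (0 : ℝ), HasDerivAt g (1 / (t * √t) * (Real.exp (-(Real.pi * A ^ 2 * t)) *
      Real.exp (-(Real.pi * B ^ 2 / t)))) t := by
    intro t ht
    refine (BF_hasDerivAt hB ht).congr_of_eventuallyEq ?_
    filter_upwards [eventually_ne_nhds (ne_of_gt ht)] with u hu
    simp [g, hu]
  have hpos : ∀ t ∈ Set.Ioi (0 : ℝ), 0 ≤ (1 / (t * √t) * (Real.exp (-(Real.pi * A ^ 2 * t)) *
      Real.exp (-(Real.pi * B ^ 2 / t)))) := by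
    intro t ht
    have : (0 : ℝ) < t := ht
    positivity
  have ht := (BF_top (B := B) hA).congr' (f₂ := g) (by
    filter_upwards [eventually_ne_atTop 0] with u hu
    simp [g, hu])
  refine ⟨integrableOn_Ioi_deriv_of_nonneg hg hd hpos ht, ?_⟩
  rw [integral_Ioi_of_hasDerivAt_of_nonneg hg hd hpos ht]
  simp only [g, Function.update_self, hc]
  ring

end CS
end

section
open Filter Topology MeasureTheory

namespace CS

lemma phi_mellin_term {x y : ℝ} (hy : 0 < y) (p : ℤ × ℤ) :
    IntegrableOn (fun t : ℝ => (t : ℂ) ^ ((-1 / 2 : ℂ) - 1) • phi x y p t) (Set.Ioi 0) ∧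
    (∫ t in Set.Ioi (0 : ℝ), ‖(t : ℂ) ^ ((-1 / 2 : ℂ) - 1) • phi x y p t‖) =
      (if p.1 = 0 ∨ p.2 = 0 then 0 else Real.exp (-(2 * Real.pi * (|(p.1 : ℝ)| * y) * |(p.2 : ℝ)|)) / |(p.2 : ℝ)|) ∧
    (∫ t in Set.Ioi (0 : ℝ), (t : ℂ) ^ ((-1 / 2 : ℂ) - 1) • phi x y p t) =
      (if p.1 = 0 ∨ p.2 = 0 then 0 else
        ((Real.exp (-(2 * Real.pi * (|(p.1 : ℝ)| * y) * |(p.2 : ℝ)|)) / |(p.2 : ℝ)| : ℝ) : ℂ) *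
        Complex.exp (2 * Real.pi * Complex.I * (p.1 * x : ℝ) * p.2)) := by
  by_cases h : p.1 = 0 ∨ p.2 = 0
  · simp [phi, h]
  · simp only [h, if_false]
    have h' := h
    push Not at h
    have h1 : 0 < |(p.1 : ℝ)| * y := mul_pos (abs_pos.mpr (by exact_mod_cast h.1)) hy
    have h2 : 0 < |(p.2 : ℝ)| := abs_pos.mpr (by exact_mod_cast h.2)
    obtain ⟨hi, hv⟩ := bessel_half h1 h2
    have hpow : ∀ t ∈ Set.Ioi (0 : ℝ), (t : ℂ) ^ ((-1 / 2 : ℂ) - 1) = ((1 / (t * √t) : ℝ) : ℂ) := by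
      intro t ht
      have ht : (0 : ℝ) < t := ht
      rw [show ((-1 / 2 : ℂ) - 1) = ((-(1 + 1 / 2) : ℝ) : ℂ) by push_cast; ring,
        ← Complex.ofReal_cpow ht.le, Real.rpow_neg ht.le, Real.rpow_add ht, Real.rpow_one,
        ← Real.sqrt_eq_rpow, one_div]
    have hfun : Set.EqOn (fun t : ℝ => (t : ℂ) ^ ((-1 / 2 : ℂ) - 1) • phi x y p t)
        (fun t : ℝ => ((1 / (t * √t) * (Real.exp (-(Real.pi * (|(p.1 : ℝ)| * y) ^ 2 * t)) *
      Real.exp (-(Real.pi * |(p.2 : ℝ)| ^ 2 / t))) : ℝ) : ℂ) *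
        Complex.exp (2 * Real.pi * Complex.I * (p.1 * x : ℝ) * p.2)) (Set.Ioi 0) := by
      intro t ht
      simp only
      rw [hpow t ht]
      simp only [phi, h', if_false, smul_eq_mul]
      rw [mul_pow |(p.1 : ℝ)|, sq_abs, sq_abs, mul_pow (p.1 : ℝ)]
      push_cast
      ring
    refine ⟨?_, ?_, ?_⟩
    · rw [integrableOn_congr_fun hfun measurableSet_Ioi]
      exact hi.ofReal.mul_const _
    · rw [← hv]
      refine setIntegral_congr_fun measurableSet_Ioi fun t ht => ?_
      have := hfun ht
      simp only at this ⊢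
      rw [this]
      have ht : (0 : ℝ) < t := ht
      rw [norm_mul, norm_unit_exp, mul_one, Complex.norm_real, Real.norm_of_nonneg (by positivity)]
    · rw [setIntegral_congr_fun measurableSet_Ioi hfun, ← hv, integral_mul_const]
      congr 1
      exact integral_ofReal (𝕜 := ℂ)

noncomputable def ST (x y : ℝ) (p : ℤ × ℤ) : ℂ := (if p.1 = 0 ∨ p.2 = 0 then 0 else
        ((Real.exp (-(2 * Real.pi * (|(p.1 : ℝ)| * y) * |(p.2 : ℝ)|)) / |(p.2 : ℝ)| : ℝ) : ℂ) *
        Complex.exp (2 * Real.pi * Complex.I * (p.1 * x : ℝ) * p.2))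

lemma mellin_Phi_hasSum {x y : ℝ} (hy : 0 < y) :
    HasSum (ST x y) (mellin (Phi x y) (-1 / 2)) := by
  have hpi := Real.pi_pos
  have h := hasSum_integral_of_summable_integral_norm (μ := volume.restrict (Set.Ioi (0 : ℝ)))
    (F := fun p t => (t : ℂ) ^ ((-1 / 2 : ℂ) - 1) • phi x y p t)
    (fun p => (phi_mellin_term hy p).1) (by
      simp only [fun p => (phi_mellin_term (x := x) hy p).2.1]
      refine Summable.of_nonneg_of_le (fun p => ?_) (fun p => ?_)
        ((summable_pq (a := 1) (b := 1) le_rfl le_rfl).mul_left (2 / (2 * Real.pi * y) ^ 2))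
      · split_ifs <;> positivity
      · split_ifs with h
        · positivity
        · push Not at h
          have h1 : 0 < |(p.1 : ℝ)| := (abs_pos.mpr (by exact_mod_cast h.1))
          have h2 : 0 < |(p.2 : ℝ)| := abs_pos.mpr (by exact_mod_cast h.2)
          have h2' : 1 ≤ |(p.2 : ℝ)| := by
            rw [← Int.cast_abs]; exact_mod_cast Int.one_le_abs h.2
          have := exp_neg_le 2 (u := (2 * Real.pi * (|(p.1 : ℝ)| * y) * |(p.2 : ℝ)|)) (by positivity)
          calc _ ≤ Real.exp (-(2 * Real.pi * (|(p.1 : ℝ)| * y) * |(p.2 : ℝ)|)) :=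
                div_le_self (by positivity) h2'
            _ ≤ _ := this
            _ = _ := by
              simp only [Nat.factorial]
              push_cast
              field_simp
              try ring)
  have e : (∫ t in Set.Ioi (0 : ℝ), ∑' p, (t : ℂ) ^ ((-1 / 2 : ℂ) - 1) • phi x y p t) =
      mellin (Phi x y) (-1 / 2) := by
    unfold mellin Phi
    refine setIntegral_congr_fun measurableSet_Ioi fun t ht => ?_
    simp only [smul_eq_mul]
    exact tsum_mul_left
  rw [← e]
  exact h.congr_fun' fun p => (phi_mellin_term hy p).2.2.symm

lemma hasSum_log_int {z : ℂ} (hz : ‖z‖ < 1) {f : ℤ → ℂ} (h0 : f 0 = 0)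
    (hp : ∀ n : ℕ, f n = z ^ n / n) (hn : ∀ n : ℕ, f (-n) = (starRingEnd ℂ z) ^ n / n) :
    HasSum f ((-2 * Real.log ‖1 - z‖ : ℝ) : ℂ) := by
  have h1 := Complex.hasSum_taylorSeries_neg_log hz
  have h2 := Complex.hasSum_conj'.mpr h1
  have h3 := HasSum.of_nat_of_neg (f := f) (h1.congr_fun' hp) (h2.congr_fun' (by
    intro n; rw [hn]; simp))
  rw [h0, sub_zero, Complex.add_conj] at h3
  simpa [Complex.log_re] using! h3

lemma ST_fiber {x y : ℝ} (hy : 0 < y) (m : ℤ) : HasSum (fun k => ST x y (m, k))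
    ((if m = 0 then 0 else -2 * Real.log ‖1 - Complex.exp (2 * Real.pi * Complex.I * (⟨x, y⟩ : ℂ)) ^ m.natAbs‖ : ℝ) : ℂ) := by
  have hpi := Real.pi_pos
  have hτ : (⟨x, y⟩ : ℂ) = x + y * Complex.I := Complex.mk_eq_add_mul_I x y
  by_cases hm : m = 0
  · subst hm; simp [ST, hasSum_zero]
  · simp only [hm, if_false]
    set q := Complex.exp (2 * Real.pi * Complex.I * (⟨x, y⟩ : ℂ)) with hq
    set z : ℂ := Complex.exp (2 * Real.pi * Complex.I * (m * x : ℝ) - 2 * Real.pi * (|m| : ℝ) * y) with hzdef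
    have hm' : 0 < |(m : ℝ)| := abs_pos.mpr (by exact_mod_cast hm)
    have hz : ‖z‖ < 1 := by
      rw [hzdef, Complex.norm_exp]
      simp
      positivity
    have key : ‖1 - z‖ = ‖1 - q ^ m.natAbs‖ := by
      rcases Int.natAbs_eq m with h | h
      · congr 2
        rw [hq, ← Complex.exp_nat_mul, hzdef, hτ]
        congr 1
        have : (m : ℝ) = m.natAbs := by conv_lhs => rw [h, Int.cast_natCast]
        rw [this, abs_of_nonneg (by positivity)]
        push_cast
        linear_combination (-2 * Real.pi * (m.natAbs : ℂ) * y) * Complex.I_sq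
      · rw [← Complex.norm_conj]
        congr 1
        rw [map_sub, map_one, hq, ← Complex.exp_nat_mul, hzdef, hτ, ← Complex.exp_conj]
        congr 2
        have : (m : ℝ) = -m.natAbs := by conv_lhs => rw [h, Int.cast_neg, Int.cast_natCast]
        rw [this, abs_neg, abs_of_nonneg (by positivity)]
        simp only [map_sub, map_mul, Complex.conj_I, Complex.conj_ofReal, map_ofNat]
        push_cast
        linear_combination (-2 * Real.pi * (m.natAbs : ℂ) * y) * Complex.I_sq
    rw [← key]
    refine hasSum_log_int hz (by simp [ST]) (fun n => ?_) (fun n => ?_)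
    · rcases Nat.eq_zero_or_pos n with rfl | hn
      · simp [ST]
      · have : (n : ℤ) ≠ 0 := by omega
        simp only [ST, hm, this, or_self, if_false]
        rw [hzdef, ← Complex.exp_nat_mul]
        push_cast
        rw [abs_of_nonneg (by positivity : (0 : ℝ) ≤ n), div_mul_eq_mul_div, ← Complex.exp_add]
        congr 2
        push_cast; ring
    · rcases Nat.eq_zero_or_pos n with rfl | hn
      · simp [ST]
      · have : -(n : ℤ) ≠ 0 := by omega
        simp only [ST, hm, this, or_self, if_false]
        rw [hzdef, ← Complex.exp_conj, ← Complex.exp_nat_mul]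
        push_cast
        rw [abs_neg, abs_of_nonneg (by positivity : (0 : ℝ) ≤ n), div_mul_eq_mul_div, ← Complex.exp_add]
        congr 2
        simp only [map_sub, map_mul, Complex.conj_I, Complex.conj_ofReal, map_ofNat, map_intCast]
        push_cast; ring

lemma tprod_pow_aux {q : ℂ} (h : ‖q‖ < 1) (k : ℕ) :
    ∏' n : ℕ, (1 - q ^ (n + 1)) ^ k = (∏' n : ℕ, (1 - q ^ (n + 1))) ^ k :=
  (ModularForm.multipliable_one_sub_pow h).tprod_pow k

lemma Delta_eq {τ : ℂ} (h : ‖Complex.exp (2 * Real.pi * Complex.I * τ)‖ < 1) :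
    RamanujanDelta τ = Complex.exp (2 * Real.pi * Complex.I * τ) *
      (∏' n : ℕ, (1 - Complex.exp (2 * Real.pi * Complex.I * τ) ^ (n + 1))) ^ 24 := by
  rw [← tprod_pow_aux h 24, RamanujanDelta]
  have e : ∀ n : ℕ, Complex.exp (2 * Real.pi * Complex.I * ((n : ℂ) + 1) * τ) =
      Complex.exp (2 * Real.pi * Complex.I * τ) ^ (n + 1) := by
    intro n
    rw [← Complex.exp_nat_mul]
    congr 1
    push_cast; ring
  simp only [e]

lemma log_Delta {x y : ℝ} (hy : 0 < y) :
    RamanujanDelta ⟨x, y⟩ ≠ 0 ∧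
    mellin (Phi x y) (-1 / 2) = ((-(1 / 6) * Real.log ‖RamanujanDelta ⟨x, y⟩‖ - Real.pi * y / 3 : ℝ) : ℂ) := by
  have hpi := Real.pi_pos
  have h := (mellin_Phi_hasSum (x := x) hy).prod_fiberwise (fun m => ST_fiber hy m)
  set q := Complex.exp (2 * Real.pi * Complex.I * (⟨x, y⟩ : ℂ)) with hq
  have hqn : ‖q‖ = Real.exp (-(2 * Real.pi * y)) := by
    rw [hq, Complex.norm_exp]; simp
  have hq1 : ‖q‖ < 1 := by rw [hqn]; simp; positivity
  obtain ⟨S, hS, hSm⟩ : ∃ S : ℝ, HasSum (fun m : ℤ => (if m = 0 then 0 else -2 * Real.log ‖1 - q ^ m.natAbs‖ : ℝ)) S ∧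
      mellin (Phi x y) (-1 / 2) = S := by
    have := (Complex.hasSum_iff _ _).mp h
    refine ⟨_, by simpa only [Complex.ofReal_re] using! this.1, ?_⟩
    have h2 := this.2
    simp only [Complex.ofReal_im] at h2
    have := h2.unique hasSum_zero
    exact Complex.ext rfl (by simpa using this)
  have hsn : Summable (fun n : ℕ => Real.log ‖1 - q ^ (n + 1)‖) := by
    have hinj : Function.Injective (fun n : ℕ => ((n + 1 : ℕ) : ℤ)) := fun a b hab => by
      simp at hab; omega
    have := (hS.summable.comp_injective hinj).mul_left (-1/2)
    refine this.congr fun n => ?_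
    have h0 : ((n : ℤ) + 1) ≠ 0 := by omega
    have h1 : ((n : ℤ) + 1).natAbs = n + 1 := by omega
    simp [h0, h1]
    ring
  set Lg := ∑' n : ℕ, Real.log ‖1 - q ^ (n + 1)‖ with hLg
  have hSL : S = -4 * Lg := by
    have h1 := hsn.hasSum.mul_left (-2)
    have hp0 : HasSum (fun n : ℕ => (fun m : ℤ => (if m = 0 then 0 else -2 * Real.log ‖1 - q ^ m.natAbs‖ : ℝ)) n)
        (-2 * Lg) := by
      rw [← hasSum_nat_add_iff' 1]
      simp only [Finset.range_one, Finset.sum_singleton, Nat.cast_zero, if_true, sub_zero]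
      have e : ∀ n : ℕ, (if ((n + 1 : ℕ) : ℤ) = 0 then 0 else
          -2 * Real.log ‖1 - q ^ ((n + 1 : ℕ) : ℤ).natAbs‖ : ℝ) = -2 * Real.log ‖1 - q ^ (n + 1)‖ := by
        intro n
        have h0 : ((n + 1 : ℕ) : ℤ) ≠ 0 := by omega
        rw [if_neg h0, Int.natAbs_natCast]
      rw [funext e]
      exact h1
    have := HasSum.of_nat_of_neg (f := (fun m : ℤ => (if m = 0 then 0 else -2 * Real.log ‖1 - q ^ m.natAbs‖ : ℝ)))
      hp0 (by simpa using hp0)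
    have := hS.unique this
    rw [this]; simp; ring
  have hne : ∀ n : ℕ, 1 - q ^ (n + 1) ≠ 0 := by
    intro n hn
    have : ‖q ^ (n + 1)‖ < 1 := by rw [norm_pow]; exact pow_lt_one₀ (norm_nonneg _) hq1 (by omega)
    rw [← sub_eq_zero.mp hn, norm_one] at this
    exact lt_irrefl _ this
  have hm := ModularForm.multipliable_one_sub_pow hq1
  have hprod : ‖∏' n : ℕ, (1 - q ^ (n + 1))‖ = Real.exp Lg := by
    rw [hm.norm_tprod]
    have := hsn.hasSum.rexp.tprod_eq
    rw [← this]
    refine tprod_congr fun n => ?_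
    simp [Real.exp_log (norm_pos_iff.mpr (hne n))]
  have hD : RamanujanDelta ⟨x, y⟩ = q * (∏' n : ℕ, (1 - q ^ (n + 1))) ^ 24 := Delta_eq hq1
  have hDn : ‖RamanujanDelta ⟨x, y⟩‖ = Real.exp (-(2 * Real.pi * y) + 24 * Lg) := by
    rw [hD, norm_mul, norm_pow, hprod, hqn, Real.exp_add, ← Real.exp_nat_mul]
    norm_num
  refine ⟨?_, ?_⟩
  · rw [← norm_pos_iff, hDn]; positivity
  · rw [hSm, hSL, hDn, Real.log_exp]
    congr 1
    ring

/-- **Kronecker limit formula** at `s = 0`. -/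
lemma kronecker {x y : ℝ} (hy : 0 < y) :
    Ep x y 0 = -1 ∧ HasDerivAt (Ep x y) ((-Real.log y - 2 * Real.log (2 * Real.pi) -
      (1 / 6) * Real.log ‖RamanujanDelta ⟨x, y⟩‖ : ℝ) : ℂ) 0 := by
  obtain ⟨h1, h2⟩ := Ep_hasDerivAt (x := x) hy
  refine ⟨h1, h2.congr_deriv ?_⟩
  rw [(log_Delta hy).2, deriv_riemannZeta_zero]
  have : Complex.log (2 * Real.pi) = (Real.log (2 * Real.pi) : ℂ) := by
    rw [Complex.ofReal_log (by positivity)]; push_cast; rfl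
  rw [this]
  push_cast
  ring

end CS
end

section
open Ideal
set_option linter.unusedSectionVars false

namespace CS

section counting
variable {S : Type*} [CommRing S] [IsDedekindDomain S] [Module.Free ℤ S] [Module.Finite ℤ S]
  [CharZero S]

theorem isCoprime_of_absNorm {A B : Ideal S} (h : (absNorm A).Coprime (absNorm B)) :
    IsCoprime A B := by
  rw [Ideal.isCoprime_iff_sup_eq, ← absNorm_eq_one_iff]
  exact Nat.eq_one_of_dvd_coprimes h (absNorm_dvd_absNorm_of_le le_sup_left)
    (absNorm_dvd_absNorm_of_le le_sup_right)

theorem card_norm_mul {m n : ℕ} (hm : m ≠ 0) (hn : n ≠ 0) (h : m.Coprime n) :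
    Nat.card {I : Ideal S // absNorm I = m * n} =
      Nat.card {I : Ideal S // absNorm I = m} * Nat.card {I : Ideal S // absNorm I = n} := by
  rw [← Nat.card_prod]
  symm
  refine Nat.card_congr (Equiv.ofBijective
    (fun p => ⟨p.1.1 * p.2.1, by rw [map_mul, p.1.2, p.2.2]⟩) ⟨?_, ?_⟩)
  · rintro ⟨⟨A, hA⟩, ⟨B, hB⟩⟩ ⟨⟨A', hA'⟩, ⟨B', hB'⟩⟩ hh
    simp only [Subtype.mk.injEq] at hh
    have key : ∀ {A A' B B' : Ideal S}, absNorm A = m → absNorm B' = n → A * B = A' * B' →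
        A' ≤ A := by
      intro A A' B B' hA hB hh
      rw [← Ideal.dvd_iff_le]
      have hc : IsCoprime A B' := isCoprime_of_absNorm (by rw [hA, hB]; exact h)
      refine hc.dvd_of_dvd_mul_right ?_
      rw [← hh]; exact dvd_mul_right _ _
    have key2 : ∀ {A A' B B' : Ideal S}, absNorm B = n → absNorm A' = m → A * B = A' * B' →
        B' ≤ B := by
      intro A A' B B' hB hA hh
      rw [← Ideal.dvd_iff_le]
      have hc : IsCoprime B A' := isCoprime_of_absNorm (by rw [hA, hB]; exact h.symm)
      refine hc.dvd_of_dvd_mul_left ?_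
      rw [← hh]; exact dvd_mul_left _ _
    have h1 : A = A' := le_antisymm (key hA' hB hh.symm) (key hA hB' hh)
    have h2 : B = B' := le_antisymm (key2 hB' hA hh.symm) (key2 hB hA' hh)
    simp [h1, h2]
  · rintro ⟨I, hI⟩
    set A := I ⊔ span {(m : S)} with hAdef
    set B := I ⊔ span {(n : S)} with hBdef
    have hmnI : span {(m : S)} * span {(n : S)} ≤ I := by
      rw [Ideal.span_singleton_mul_span_singleton, Ideal.span_singleton_le_iff_mem, ← Nat.cast_mul,
        ← hI]
      exact absNorm_mem I
    have htop : span {(m : S)} ⊔ span {(n : S)} = ⊤ := by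
      rw [← Ideal.isCoprime_iff_sup_eq, Ideal.isCoprime_span_singleton_iff]
      exact h.cast
    have hAB : A * B = I := by
      apply le_antisymm
      · rw [hAdef, hBdef, Ideal.sup_mul, Ideal.mul_sup (span _)]
        exact sup_le Ideal.mul_le_left (sup_le Ideal.mul_le_right hmnI)
      · calc I = I * (span {(m : S)} ⊔ span {(n : S)}) := by rw [htop, Ideal.mul_top]
          _ = span {(m : S)} * I ⊔ I * span {(n : S)} := by rw [Ideal.mul_sup, mul_comm I]
          _ ≤ A * B := sup_le (Ideal.mul_mono le_sup_right le_sup_left)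
              (Ideal.mul_mono le_sup_left le_sup_right)
    have hA1 : absNorm A ∣ m := by
      have h1 : absNorm A ∣ m * n := hI ▸ absNorm_dvd_absNorm_of_le le_sup_left
      have h2 : absNorm A ∣ m ^ Module.finrank ℤ S := by
        rw [← absNorm_span_natCast]; exact absNorm_dvd_absNorm_of_le le_sup_right
      exact (Nat.Coprime.coprime_dvd_left h2 (h.pow_left _)).dvd_of_dvd_mul_right h1
    have hB1 : absNorm B ∣ n := by
      have h1 : absNorm B ∣ m * n := hI ▸ absNorm_dvd_absNorm_of_le le_sup_left
      have h2 : absNorm B ∣ n ^ Module.finrank ℤ S := by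
        rw [← absNorm_span_natCast]; exact absNorm_dvd_absNorm_of_le le_sup_right
      exact (Nat.Coprime.coprime_dvd_left h2 (h.symm.pow_left _)).dvd_of_dvd_mul_left h1
    have hprod : absNorm A * absNorm B = m * n := by rw [← map_mul, hAB, hI]
    have hAle := Nat.le_of_dvd (Nat.pos_of_ne_zero hm) hA1
    have hBle := Nat.le_of_dvd (Nat.pos_of_ne_zero hn) hB1
    have hA : absNorm A = m := by
      refine le_antisymm hAle ?_
      have : m * n ≤ absNorm A * n := by rw [← hprod]; gcongr
      exact Nat.le_of_mul_le_mul_right this (Nat.pos_of_ne_zero hn)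
    have hB : absNorm B = n := by
      rw [hA] at hprod
      exact Nat.eq_of_mul_eq_mul_left (Nat.pos_of_ne_zero hm) hprod
    exact ⟨⟨⟨A, hA⟩, ⟨B, hB⟩⟩, by simp [hAB]⟩

variable (S) in
/-- number of ideals of given norm -/
noncomputable def cnt : ArithmeticFunction ℤ :=
  ⟨fun n => if n = 0 then 0 else Nat.card {I : Ideal S // absNorm I = n}, by simp⟩

theorem cnt_apply {n : ℕ} (hn : n ≠ 0) : cnt S n = Nat.card {I : Ideal S // absNorm I = n} := by
  simp [cnt, hn]

theorem cnt_mult : (cnt S).IsMultiplicative := by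
  rw [ArithmeticFunction.IsMultiplicative.iff_ne_zero]
  constructor
  · rw [cnt_apply one_ne_zero]
    have : Nat.card {I : Ideal S // absNorm I = 1} = 1 := by
      simp [absNorm_eq_one_iff]
    rw [this]; rfl
  · intro m n hm hn h
    rw [cnt_apply hm, cnt_apply hn, cnt_apply (mul_ne_zero hm hn), card_norm_mul hm hn h]
    push_cast; ring

/-- An ideal of norm `p^k` is a product of powers of primes above `p`. -/
theorem eq_of_norm_pow {p : ℕ} (hp : p.Prime) (P P' : Ideal S)
    (hPP : ∀ Q : Ideal S, Q.IsPrime → (p : S) ∈ Q → Q = P ∨ Q = P') :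
    ∀ (k : ℕ) (I : Ideal S), absNorm I = p ^ k → ∃ a b : ℕ, I = P ^ a * P' ^ b := by
  intro k
  induction k using Nat.strong_induction_on with
  | _ k ih =>
  intro I hI
  by_cases hk : k = 0
  · subst hk
    rw [pow_zero, absNorm_eq_one_iff] at hI
    exact ⟨0, 0, by simp [hI]⟩
  have hItop : I ≠ ⊤ := by
    rw [Ne, ← absNorm_eq_one_iff, hI]
    exact (Nat.one_lt_pow hk hp.one_lt).ne'
  obtain ⟨Q, hQ, hIQ⟩ := Ideal.exists_le_maximal I hItop
  have hpQ : (p : S) ∈ Q := by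
    have : ((p ^ k : ℕ) : S) ∈ Q := hIQ (hI ▸ absNorm_mem I)
    rw [Nat.cast_pow] at this
    exact hQ.isPrime.mem_of_pow_mem _ this
  obtain ⟨J, rfl⟩ := Ideal.dvd_iff_le.mpr hIQ
  rw [map_mul] at hI
  obtain ⟨j, hj, hJ⟩ := (Nat.dvd_prime_pow hp).mp (Dvd.intro_left _ hI)
  have hjk : j ≠ k := by
    rintro rfl
    rw [hJ] at hI
    have : absNorm Q = 1 := by
      have hpos : 0 < p ^ j := pow_pos hp.pos _
      exact Nat.eq_of_mul_eq_mul_right hpos (by rw [hI, one_mul])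
    exact hQ.ne_top (absNorm_eq_one_iff.mp this)
  obtain ⟨a, b, hab⟩ := ih j (lt_of_le_of_ne hj hjk) J hJ
  rcases hPP Q hQ.isPrime hpQ with h | h
  · exact ⟨a + 1, b, by rw [hab, h]; ring⟩
  · exact ⟨a, b + 1, by rw [hab, h]; ring⟩

end counting
end CS
end

section
open Ideal
set_option linter.unusedSectionVars false
namespace CS

section counting
variable {S : Type*} [CommRing S] [IsDedekindDomain S] [Module.Free ℤ S] [Module.Finite ℤ S]
  [CharZero S]

theorem span_p_ne_bot {p : ℕ} (hp : p.Prime) : (span {(p : S)}) ≠ ⊥ := by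
  simp [hp.ne_zero]

theorem prime_eq_of_le {p : ℕ} (hp : p.Prime) {P Q : Ideal S} (hP : P.IsPrime) (hQ : Q.IsPrime)
    (hpP : (p : S) ∈ P) (h : P ≤ Q) : Q = P := by
  have hb : P ≠ ⊥ := by
    rintro rfl
    simp [hp.ne_zero] at hpP
  exact ((hP.isMaximal hb).eq_of_le hQ.ne_top h).symm

theorem cnt_inert (h2 : Module.finrank ℤ S = 2) {p : ℕ} (hp : p.Prime)
    (hI : (span {(p : S)}).IsPrime) (k : ℕ) :
    cnt S (p ^ k) = ∑ j ∈ Finset.range (k + 1), (-1 : ℤ) ^ j := by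
  have hN : absNorm (span {(p : S)}) = p ^ 2 := by rw [absNorm_span_natCast, h2]
  have hall : ∀ Q : Ideal S, Q.IsPrime → (p : S) ∈ Q → Q = span {(p : S)} ∨ Q = span {(p : S)} := by
    intro Q hQ hpQ
    left
    exact prime_eq_of_le hp hI hQ (mem_span_singleton_self _)
      ((span_singleton_le_iff_mem _).mpr hpQ)
  have hchar : ∀ I : Ideal S, absNorm I = p ^ k → ∃ j, k = 2 * j ∧ I = span {(p : S)} ^ j := by
    intro I hI
    obtain ⟨a, b, hab⟩ := eq_of_norm_pow hp _ _ hall k I hI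
    rw [← pow_add] at hab
    refine ⟨a + b, ?_, hab⟩
    rw [hab, map_pow, hN, ← pow_mul] at hI
    exact (Nat.pow_right_injective hp.two_le hI).symm
  rw [cnt_apply (pow_ne_zero _ hp.ne_zero)]
  rw [neg_one_geom_sum]
  split_ifs with hk
  · have : IsEmpty {I : Ideal S // absNorm I = p ^ k} := by
      refine ⟨fun ⟨I, hI⟩ => ?_⟩
      obtain ⟨j, hj, -⟩ := hchar I hI
      rcases hk with ⟨t, ht⟩
      omega
    simp
  · have hk' : ∃ j, k = 2 * j := by
      rw [Nat.not_even_iff_odd] at hk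
      obtain ⟨j, hj⟩ := hk
      exact ⟨j, by omega⟩
    obtain ⟨j, hj⟩ := hk'
    have : Nat.card {I : Ideal S // absNorm I = p ^ k} = 1 := by
      rw [Nat.card_eq_one_iff_unique]
      refine ⟨⟨?_⟩, ⟨⟨span {(p : S)} ^ j, by rw [map_pow, hN, ← pow_mul, hj]⟩⟩⟩
      rintro ⟨I, hI⟩ ⟨J, hJ⟩
      obtain ⟨i, hi, rfl⟩ := hchar I hI
      obtain ⟨i', hi', rfl⟩ := hchar J hJ
      have : i = i' := by omega
      simp [this]
    rw [this]; rfl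

theorem cnt_ram (h2 : Module.finrank ℤ S = 2) {p : ℕ} (hp : p.Prime)
    {Q : Ideal S} (hQ : Q.IsPrime) (hQ2 : Q ^ 2 = span {(p : S)}) (k : ℕ) :
    cnt S (p ^ k) = 1 := by
  have hN : absNorm (span {(p : S)}) = p ^ 2 := by rw [absNorm_span_natCast, h2]
  have hNQ : absNorm Q = p := by
    rw [← hQ2, map_pow] at hN
    exact Nat.pow_left_injective two_ne_zero hN
  have hpQ : (p : S) ∈ Q := by
    have : (p : S) ∈ Q ^ 2 := by rw [hQ2]; exact mem_span_singleton_self _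
    exact Ideal.pow_le_self two_ne_zero this
  have hall : ∀ Q' : Ideal S, Q'.IsPrime → (p : S) ∈ Q' → Q' = Q ∨ Q' = Q := by
    intro Q' hQ' hpQ'
    left
    refine prime_eq_of_le hp hQ hQ' hpQ ?_
    have : Q ^ 2 ≤ Q' := by rw [hQ2]; exact (span_singleton_le_iff_mem _).mpr hpQ'
    exact (hQ'.pow_le_iff two_ne_zero).mp this
  rw [cnt_apply (pow_ne_zero _ hp.ne_zero)]
  have : Nat.card {I : Ideal S // absNorm I = p ^ k} = 1 := by
    rw [Nat.card_eq_one_iff_unique]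
    refine ⟨⟨?_⟩, ⟨⟨Q ^ k, by rw [map_pow, hNQ]⟩⟩⟩
    have : ∀ I : Ideal S, absNorm I = p ^ k → I = Q ^ k := by
      intro I hI
      obtain ⟨a, b, hab⟩ := eq_of_norm_pow hp _ _ hall k I hI
      rw [← pow_add] at hab
      rw [hab, map_pow, hNQ] at hI
      rw [hab, Nat.pow_right_injective hp.two_le hI]
    rintro ⟨I, hI⟩ ⟨J, hJ⟩
    simp [this I hI, this J hJ]
  rw [this]; rfl

theorem cnt_split (h2 : Module.finrank ℤ S = 2) {p : ℕ} (hp : p.Prime)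
    (hI : ¬ (span {(p : S)}).IsPrime)
    (hunr : ∀ Q : Ideal S, Q.IsPrime → Q ^ 2 ≠ span {(p : S)}) (k : ℕ) :
    cnt S (p ^ k) = k + 1 := by
  have hN : absNorm (span {(p : S)}) = p ^ 2 := by rw [absNorm_span_natCast, h2]
  have htop : span {(p : S)} ≠ ⊤ := by
    rw [Ne, ← absNorm_eq_one_iff, hN]
    exact (Nat.one_lt_pow two_ne_zero hp.one_lt).ne'
  obtain ⟨P, hP, hIP⟩ := Ideal.exists_le_maximal _ htop
  obtain ⟨P', hPP'⟩ := Ideal.dvd_iff_le.mpr hIP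
  have hNN : absNorm P * absNorm P' = p * p := by rw [← map_mul, ← hPP', hN, sq]
  have hNP1 : absNorm P ≠ 1 := fun h => hP.ne_top (absNorm_eq_one_iff.mp h)
  have hNP'1 : absNorm P' ≠ 1 := by
    intro h
    rw [absNorm_eq_one_iff.mp h, Ideal.mul_top] at hPP'
    exact hI (hPP' ▸ hP.isPrime)
  obtain ⟨hNP, hNP'⟩ : absNorm P = p ∧ absNorm P' = p := by
    exact (hp.mul_eq_prime_sq_iff hNP1 hNP'1).mp (by rw [hNN, sq])
  have hPpr := hP.isPrime
  have hP'pr : P'.IsPrime := isPrime_of_irreducible_absNorm (by rw [hNP']; exact hp)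
  have hne : P ≠ P' := by
    intro h
    exact hunr P hPpr (by rw [hPP', ← h, sq])
  have hpP : (p : S) ∈ P := hIP (mem_span_singleton_self _)
  have hpP' : (p : S) ∈ P' := by
    have := absNorm_mem P'
    rwa [hNP'] at this
  have hall : ∀ Q' : Ideal S, Q'.IsPrime → (p : S) ∈ Q' → Q' = P ∨ Q' = P' := by
    intro Q' hQ' hpQ'
    have : P * P' ≤ Q' := by rw [← hPP']; exact (span_singleton_le_iff_mem _).mpr hpQ'
    rcases hQ'.mul_le.mp this with h | h
    · left; exact prime_eq_of_le hp hPpr hQ' hpP h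
    · right; exact prime_eq_of_le hp hP'pr hQ' hpP' h
  have hcop : IsCoprime P P' := by
    rw [Ideal.isCoprime_iff_sup_eq]
    by_contra hcon
    obtain ⟨M, hM, hMle⟩ := Ideal.exists_le_maximal _ hcon
    have h1 := prime_eq_of_le hp hPpr hM.isPrime hpP (le_sup_left.trans hMle)
    have h2 := prime_eq_of_le hp hP'pr hM.isPrime hpP' (le_sup_right.trans hMle)
    exact hne (h1.symm.trans h2)
  rw [cnt_apply (pow_ne_zero _ hp.ne_zero)]
  have : Nat.card (Fin (k + 1)) = Nat.card {I : Ideal S // absNorm I = p ^ k} := by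
    refine Nat.card_congr (Equiv.ofBijective
      (fun a => ⟨P ^ (a : ℕ) * P' ^ (k - a : ℕ), ?_⟩) ⟨?_, ?_⟩)
    · rw [map_mul, map_pow, map_pow, hNP, hNP', ← pow_add]
      congr 1
      have := a.2
      omega
    · have key : ∀ a b : ℕ, P ^ a * P' ^ (k - a) = P ^ b * P' ^ (k - b) → a ≤ b := by
        intro a b hab
        have h1 : P ^ a ∣ P ^ b * P' ^ (k - b) := by rw [← hab]; exact dvd_mul_right _ _
        have h2 : P ^ a ∣ P ^ b := (hcop.pow (m := a) (n := k - b)).dvd_of_dvd_mul_right h1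
        have h3 := map_dvd absNorm h2
        rw [map_pow, map_pow, hNP] at h3
        exact (Nat.pow_dvd_pow_iff_le_right hp.one_lt).mp h3
      intro a b hab
      simp only [Subtype.mk.injEq] at hab
      exact Fin.ext (le_antisymm (key _ _ hab) (key _ _ hab.symm))
    · rintro ⟨I, hI⟩
      obtain ⟨a, b, hab⟩ := eq_of_norm_pow hp _ _ hall k I hI
      have hk : a + b = k := by
        rw [hab, map_mul, map_pow, map_pow, hNP, hNP', ← pow_add] at hI
        exact Nat.pow_right_injective hp.two_le hI
      refine ⟨⟨a, by omega⟩, ?_⟩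
      simp only [Subtype.mk.injEq]
      rw [hab, ← hk, Nat.add_sub_cancel_left]
  rw [← this]
  simp

end counting
end CS
end

section
open Ideal NumberField
namespace CS
theorem dvd_discr_iff (E : Type*) [Field E] [NumberField E] (h2 : Module.finrank ℤ (𝓞 E) = 2)
    {p : ℕ} (hp : p.Prime) :
    (p : ℤ) ∣ discr E ↔ ∃ Q : Ideal (𝓞 E), Q.IsPrime ∧ Q ^ 2 = span {(p : 𝓞 E)} := by
  have hN : absNorm (span {(p : 𝓞 E)}) = p ^ 2 := by rw [absNorm_span_natCast, h2]
  have hpZ : Prime (p : ℤ) := Nat.prime_iff_prime_int.mp hp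
  have hmap : (span {(p : ℤ)}).map (algebraMap ℤ (𝓞 E)) = span {(p : 𝓞 E)} := by
    rw [Ideal.map_span]; simp
  have hbot : span {(p : 𝓞 E)} ≠ ⊥ := span_p_ne_bot hp
  have hfin : ∀ Q : Ideal (𝓞 E), Q.IsPrime → (p : 𝓞 E) ∈ Q →
      FiniteMultiplicity Q (span {(p : 𝓞 E)}) := by
    intro Q hQ hpQ
    refine FiniteMultiplicity.of_prime_left (Ideal.prime_of_isPrime ?_ hQ) hbot
    rintro rfl
    simp [hp.ne_zero] at hpQ
  have hiff : ∀ (Q : Ideal (𝓞 E)) (_ : Q.IsPrime), (p : 𝓞 E) ∈ Q →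
      (Algebra.IsUnramifiedAt ℤ Q ↔ Q ^ 2 ≠ span {(p : 𝓞 E)}) := by
    intro Q hQ hpQ
    have : Q.LiesOver (span {(p : ℤ)}) :=
      (Ideal.liesOver_span_iff hQ.ne_top hpZ).mpr (by simpa using hpQ)
    have hdvd : Q ∣ span {(p : 𝓞 E)} :=
      Ideal.dvd_iff_le.mpr ((span_singleton_le_iff_mem _).mpr hpQ)
    rw [← Ideal.ramificationIdx_eq_one_iff,
      IsDedekindDomain.ramificationIdx_eq_multiplicity (span {(p : ℤ)}) Q (by rwa [hmap]), hmap,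
      (hfin Q hQ hpQ).multiplicity_eq_iff]
    have hno : Q ^ 2 = span {(p : 𝓞 E)} ↔ Q ^ 2 ∣ span {(p : 𝓞 E)} := by
      refine ⟨fun h => h ▸ dvd_rfl, fun ⟨J, hJ⟩ => ?_⟩
      have h1 := congrArg absNorm hJ
      rw [map_mul, map_pow, hN] at h1
      have hQ1 : absNorm Q ≠ 1 := fun h => hQ.ne_top (absNorm_eq_one_iff.mp h)
      have hQp : absNorm Q = p := by
        have : absNorm Q ∣ p := by
          rw [← Nat.pow_dvd_pow_iff two_ne_zero, h1]; exact dvd_mul_right _ _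
        exact ((Nat.dvd_prime hp).mp this).resolve_left hQ1
      rw [hQp] at h1
      have hJ1 : absNorm J = 1 :=
        Nat.eq_of_mul_eq_mul_left (pow_pos hp.pos 2) (by rw [← h1, mul_one])
      rw [absNorm_eq_one_iff.mp hJ1, Ideal.mul_top] at hJ
      exact hJ.symm
    rw [Ne, hno]
    simp [hdvd]
  rw [← not_iff_not, NumberField.not_dvd_discr_iff_forall_mem E (𝓞 E) hpZ]
  push Not
  constructor
  · intro h Q hQ hQ2
    have hpQ : (p : 𝓞 E) ∈ Q := by
      have : (p : 𝓞 E) ∈ Q ^ 2 := by rw [hQ2]; exact mem_span_singleton_self _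
      exact Ideal.pow_le_self two_ne_zero this
    exact (hiff Q hQ hpQ).mp (h Q hQ (by simpa using hpQ)) hQ2
  · intro h Q hQ hpQ
    have hpQ' : (p : 𝓞 E) ∈ Q := by simpa using hpQ
    exact (hiff Q hQ hpQ').mpr (h Q hQ)

/-- the arithmetic function of a Dirichlet character -/
noncomputable def chiA {d : ℕ} (χ : DirichletCharacter ℤ d) : ArithmeticFunction ℤ :=
  ⟨fun n => if n = 0 then 0 else χ (n : ZMod d), by simp⟩

theorem chiA_apply {d : ℕ} (χ : DirichletCharacter ℤ d) {n : ℕ} (hn : n ≠ 0) :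
    chiA χ n = χ (n : ZMod d) := by simp [chiA, hn]

theorem chiA_mult {d : ℕ} (χ : DirichletCharacter ℤ d) : (chiA χ).IsMultiplicative := by
  rw [ArithmeticFunction.IsMultiplicative.iff_ne_zero]
  constructor
  · rw [chiA_apply _ one_ne_zero]; simp
  · intro m n hm hn _
    rw [chiA_apply _ hm, chiA_apply _ hn, chiA_apply _ (mul_ne_zero hm hn)]
    push_cast
    rw [map_mul]

theorem cnt_eq (E : Type*) [Field E] [NumberField E] (h2 : Module.finrank ℤ (𝓞 E) = 2)
    (d : ℕ) (hdisc : NumberField.discr E = -(d : ℤ)) (χ : DirichletCharacter ℤ d)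
    (hχquad : ∀ u : (ZMod d)ˣ, χ u = 1 ∨ χ u = -1)
    (hχ : ∀ p : ℕ, p.Prime → ¬ p ∣ d →
      (χ (p : ZMod d) = -1 ↔ (Ideal.span {(p : 𝓞 E)} : Ideal (𝓞 E)).IsPrime)) :
    cnt (𝓞 E) = ((ArithmeticFunction.zeta : ArithmeticFunction ℕ) : ArithmeticFunction ℤ) * chiA χ := by
  rw [ArithmeticFunction.IsMultiplicative.eq_iff_eq_on_prime_powers _ cnt_mult _
    (ArithmeticFunction.isMultiplicative_zeta.natCast.mul (chiA_mult χ))]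
  intro p k hp
  rw [ArithmeticFunction.coe_zeta_mul_apply, Nat.sum_divisors_prime_pow hp]
  have hterm : ∀ j, chiA χ (p ^ j) = χ (p : ZMod d) ^ j := by
    intro j
    rw [chiA_apply _ (pow_ne_zero _ hp.ne_zero)]
    push_cast
    rw [map_pow]
  simp_rw [hterm]
  have hdd : (p : ℤ) ∣ discr E ↔ p ∣ d := by
    rw [hdisc, dvd_neg, Int.natCast_dvd_natCast]
  rw [dvd_discr_iff E h2 hp] at hdd
  by_cases hpd : p ∣ d
  · obtain ⟨Q, hQ, hQ2⟩ := hdd.mpr hpd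
    rw [cnt_ram h2 hp hQ hQ2 k]
    have h0 : χ (p : ZMod d) = 0 := by
      apply χ.map_nonunit
      rw [ZMod.isUnit_iff_coprime]
      intro h
      exact hp.one_lt.ne' (Nat.Coprime.eq_one_of_dvd h hpd)
    rw [h0, Finset.sum_range_succ']
    simp
  · have hu : IsUnit (p : ZMod d) := by
      rw [ZMod.isUnit_iff_coprime]
      exact (Nat.Prime.coprime_iff_not_dvd hp).mpr hpd
    by_cases hpp : (Ideal.span {(p : 𝓞 E)} : Ideal (𝓞 E)).IsPrime
    · rw [(hχ p hp hpd).mpr hpp, cnt_inert h2 hp hpp]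
    · rw [cnt_split h2 hp hpp (fun Q hQ hQ2 => hpd (hdd.mp ⟨Q, hQ, hQ2⟩))]
      have : χ (p : ZMod d) = 1 := by
        have h1 := hχquad hu.unit
        rw [IsUnit.unit_spec] at h1
        exact h1.resolve_right (fun h => hpp ((hχ p hp hpd).mp h))
      rw [this]; simp
end CS
end

section
open Ideal NumberField
namespace CS

/-- The complex valued character. -/
noncomputable def chiC {d : ℕ} (χ : DirichletCharacter ℤ d) : DirichletCharacter ℂ d :=
  χ.ringHomComp (Int.castRingHom ℂ)

theorem chiC_apply {d : ℕ} (χ : DirichletCharacter ℤ d) (a : ZMod d) :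
    chiC χ a = ((χ a : ℤ) : ℂ) := by
  simp [chiC, MulChar.ringHomComp_apply]

theorem cnt_hasSum (E : Type*) [Field E] [NumberField E] (h2 : Module.finrank ℤ (𝓞 E) = 2)
    (d : ℕ) [NeZero d] (hdisc : NumberField.discr E = -(d : ℤ)) (χ : DirichletCharacter ℤ d)
    (hχquad : ∀ u : (ZMod d)ˣ, χ u = 1 ∨ χ u = -1)
    (hχ : ∀ p : ℕ, p.Prime → ¬ p ∣ d →
      (χ (p : ZMod d) = -1 ↔ (Ideal.span {(p : 𝓞 E)} : Ideal (𝓞 E)).IsPrime))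
    {s : ℂ} (hs : 1 < s.re) :
    LSeriesHasSum (fun n => (cnt (𝓞 E) n : ℂ)) s
      (riemannZeta s * DirichletCharacter.LFunction (chiC χ) s) := by
  have h1 := LSeriesHasSum_one hs
  have h3 : LSeriesHasSum (fun n : ℕ => chiC χ (n : ZMod d)) s
      (DirichletCharacter.LFunction (chiC χ) s) := by
    rw [DirichletCharacter.LFunction_eq_LSeries _ hs]
    exact ((chiC χ).LSeriesSummable_of_one_lt_re hs).LSeriesHasSum
  have h4 := h1.convolution h3
  refine (LSeriesHasSum_congr _ _ ?_).mp h4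
  intro n hn
  rw [LSeries.convolution_def, cnt_eq E h2 d hdisc χ hχquad hχ,
    ArithmeticFunction.coe_zeta_mul_apply, ← Nat.sum_divisorsAntidiagonal' (f := fun _ b => chiA χ b)]
  push_cast
  refine Finset.sum_congr rfl fun p hp => ?_
  have hp0 : p.2 ≠ 0 := by
    have := (Nat.mem_divisorsAntidiagonal.mp hp)
    rintro h
    rw [h] at this
    simp at this
    exact hn this.1.symm
  rw [chiA_apply _ hp0, chiC_apply]
  simp

theorem ideal_hasSum (E : Type*) [Field E] [NumberField E] (h2 : Module.finrank ℤ (𝓞 E) = 2)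
    (d : ℕ) [NeZero d] (hdisc : NumberField.discr E = -(d : ℤ)) (χ : DirichletCharacter ℤ d)
    (hχquad : ∀ u : (ZMod d)ˣ, χ u = 1 ∨ χ u = -1)
    (hχ : ∀ p : ℕ, p.Prime → ¬ p ∣ d →
      (χ (p : ZMod d) = -1 ↔ (Ideal.span {(p : 𝓞 E)} : Ideal (𝓞 E)).IsPrime))
    {s : ℂ} (hs : 1 < s.re) :
    HasSum (fun J : Ideal (𝓞 E) => 1 / ((absNorm J : ℕ) : ℂ) ^ s)
      (riemannZeta s * DirichletCharacter.LFunction (chiC χ) s) := by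
  have hs0 : s ≠ 0 := by rintro rfl; simp at hs; linarith
  have hL := cnt_hasSum E h2 d hdisc χ hχquad hχ hs
  rw [LSeriesHasSum] at hL
  rw [← (Equiv.sigmaFiberEquiv (fun J : Ideal (𝓞 E) => absNorm J)).hasSum_iff]
  have hfinite : ∀ n : ℕ, Finite {J : Ideal (𝓞 E) // absNorm J = n} := fun n =>
    Ideal.finite_setOfPred_absNorm_eq n
  have hfib : ∀ n : ℕ, HasSum (fun c : {J : Ideal (𝓞 E) // absNorm J = n} =>
      1 / ((absNorm c.1 : ℕ) : ℂ) ^ s) (LSeries.term (fun n => (cnt (𝓞 E) n : ℂ)) s n) := by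
    intro n
    have := Fintype.ofFinite {J : Ideal (𝓞 E) // absNorm J = n}
    have h5 := hasSum_fintype (fun c : {J : Ideal (𝓞 E) // absNorm J = n} =>
      1 / ((absNorm c.1 : ℕ) : ℂ) ^ s)
    have h6 : ∑ c : {J : Ideal (𝓞 E) // absNorm J = n}, 1 / ((absNorm c.1 : ℕ) : ℂ) ^ s
        = LSeries.term (fun n => (cnt (𝓞 E) n : ℂ)) s n := by
      rw [Finset.sum_congr rfl (fun c _ => by rw [c.2])]
      rw [Finset.sum_const, Finset.card_univ, ← Nat.card_eq_fintype_card]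
      by_cases hn : n = 0
      · simp [hn, Complex.zero_cpow hs0]
      · rw [LSeries.term_of_ne_zero hn, cnt_apply hn]
        simp [div_eq_mul_inv]
    rw [h6] at h5
    exact h5
  refine HasSum.sigma_of_hasSum hL hfib ?_
  rw [← summable_norm_iff, summable_sigma_of_nonneg (fun _ => norm_nonneg _)]
  refine ⟨fun n => (hfib n).summable.norm, ?_⟩
  refine hL.summable.norm.congr fun n => ?_
  have := Fintype.ofFinite {J : Ideal (𝓞 E) // absNorm J = n}
  rw [tsum_fintype]
  have h7 : ∀ c : {J : Ideal (𝓞 E) // absNorm J = n},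
      ‖((fun J : Ideal (𝓞 E) => 1 / ((absNorm J : ℕ) : ℂ) ^ s) ∘
        ⇑(Equiv.sigmaFiberEquiv fun J : Ideal (𝓞 E) => absNorm J)) ⟨n, c⟩‖ =
      ‖1 / ((n : ℕ) : ℂ) ^ s‖ := by
    intro c
    simp only [Function.comp_apply, Equiv.sigmaFiberEquiv_apply]
    rw [c.2]
  rw [Finset.sum_congr rfl (fun c _ => h7 c)]
  rw [Finset.sum_const, Finset.card_univ, ← Nat.card_eq_fintype_card]
  by_cases hn : n = 0
  · simp [hn, Complex.zero_cpow hs0]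
  · rw [LSeries.term_of_ne_zero hn, cnt_apply hn]
    simp [div_eq_mul_inv]
end CS
end

section
open NumberField
open scoped nonZeroDivisors ComplexConjugate
namespace CS

section
variable (E : Type*) [Field E] [NumberField E]

theorem conj_ne (ι : E →+* ℂ) (d : ℕ) (hd : 0 < d)
    (hdeg : Module.finrank ℚ E = 2) (hdisc : NumberField.discr E = -(d : ℤ)) :
    ComplexEmbedding.conjugate ι ≠ ι := by
  intro hreal
  have h1 := NumberField.sign_discr E
  have h2 := InfinitePlace.card_add_two_mul_card_eq_rank E
  rw [hdeg] at h2
  have h3 : 0 < InfinitePlace.nrRealPlaces E := by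
    have : (InfinitePlace.mk ι).IsReal := ⟨ι, hreal, rfl⟩
    have hne : Nonempty {w : InfinitePlace E // w.IsReal} := ⟨⟨_, this⟩⟩
    classical
    rw [InfinitePlace.nrRealPlaces]
    exact Fintype.card_pos_iff.mpr hne
  have h4 : InfinitePlace.nrComplexPlaces E = 0 := by omega
  rw [h4, hdisc, Int.sign_neg, Int.sign_eq_one_of_pos (by exact_mod_cast hd)] at h1
  norm_num at h1

/-- the two embeddings -/
noncomputable def embEquiv (ι : E →+* ℂ) (d : ℕ) (hd : 0 < d)
    (hdeg : Module.finrank ℚ E = 2) (hdisc : NumberField.discr E = -(d : ℤ)) :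
    Fin 2 ≃ (E →ₐ[ℚ] ℂ) :=
  Equiv.ofBijective ![ι.toRatAlgHom, (ComplexEmbedding.conjugate ι).toRatAlgHom] (by
    rw [Fintype.bijective_iff_injective_and_card, AlgHom.card, hdeg, Fintype.card_fin]
    refine ⟨?_, rfl⟩
    have hne : ι.toRatAlgHom ≠ (ComplexEmbedding.conjugate ι).toRatAlgHom := by
      intro h
      apply conj_ne E ι d hd hdeg hdisc
      ext x
      have := DFunLike.congr_fun h x
      simpa using this.symm
    intro i j hij
    fin_cases i <;> fin_cases j <;> simp_all)

variable {E} (ι : E →+* ℂ) (d : ℕ) (hd : 0 < d)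
    (hdeg : Module.finrank ℚ E = 2) (hdisc : NumberField.discr E = -(d : ℤ))
include hd hdeg hdisc

theorem norm_eq (x : E) : ((Algebra.norm ℚ x : ℚ) : ℂ) = ι x * conj (ι x) := by
  have := Algebra.norm_eq_prod_embeddings ℚ ℂ x
  rw [← (embEquiv E ι d hd hdeg hdisc).prod_comp, Fin.prod_univ_two] at this
  simpa [embEquiv] using this

theorem trace_eq (x : E) : ((Algebra.trace ℚ E x : ℚ) : ℂ) = ι x + conj (ι x) := by
  have := trace_eq_sum_embeddings (K := ℚ) (L := E) ℂ (x := x)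
  rw [← (embEquiv E ι d hd hdeg hdisc).sum_comp, Fin.sum_univ_two] at this
  simpa [embEquiv] using this

theorem norm_eq_real (x : E) : ((Algebra.norm ℚ x : ℚ) : ℝ) = ‖ι x‖ ^ 2 := by
  have := norm_eq ι d hd hdeg hdisc x
  rw [Complex.mul_conj, Complex.normSq_eq_norm_sq] at this
  exact_mod_cast this

theorem discr_eq (b : Fin 2 → E) :
    ((Algebra.discr ℚ b : ℚ) : ℂ) = (ι (b 0) * conj (ι (b 1)) - ι (b 1) * conj (ι (b 0))) ^ 2 := by
  have := Algebra.discr_eq_det_embeddingsMatrixReindex_pow_two ℚ ℂ b (embEquiv E ι d hd hdeg hdisc)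
  rw [Matrix.det_fin_two] at this
  simp [embEquiv, Algebra.embeddingsMatrixReindex, Algebra.embeddingsMatrix] at this
  rw [this]; ring

/-- the conjugate -/
noncomputable def sig (x : E) : E := algebraMap ℚ E (Algebra.trace ℚ E x) - x

theorem sig_eq (x : E) : ι (sig x) = conj (ι x) := by
  have := trace_eq ι d hd hdeg hdisc x
  simp [sig, this]

end
end CS
end

section
open NumberField
open scoped nonZeroDivisors ComplexConjugate
namespace CS

section
variable {E : Type*} [Field E] [NumberField E]

theorem absNorm_unit_pos (I : (FractionalIdeal (𝓞 E)⁰ E)ˣ) :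
    0 < FractionalIdeal.absNorm (I : FractionalIdeal (𝓞 E)⁰ E) := by
  refine lt_of_le_of_ne (FractionalIdeal.absNorm_nonneg _) (Ne.symm ?_)
  rw [Ne, FractionalIdeal.absNorm_eq_zero_iff]
  exact I.ne_zero

theorem absNorm_inv (I : (FractionalIdeal (𝓞 E)⁰ E)ˣ) :
    FractionalIdeal.absNorm ((I⁻¹ : (FractionalIdeal (𝓞 E)⁰ E)ˣ) : FractionalIdeal (𝓞 E)⁰ E) =
      (FractionalIdeal.absNorm (I : FractionalIdeal (𝓞 E)⁰ E))⁻¹ := by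
  apply eq_inv_of_mul_eq_one_left
  rw [← map_mul, Units.inv_mul, map_one]

/-- the integral ideal `(a) I⁻¹` -/
theorem exists_ideal (I : (FractionalIdeal (𝓞 E)⁰ E)ˣ) {a : E}
    (ha : a ∈ (I : FractionalIdeal (𝓞 E)⁰ E)) :
    ∃ J : Ideal (𝓞 E), FractionalIdeal.spanSingleton (𝓞 E)⁰ a = J * (I : FractionalIdeal (𝓞 E)⁰ E) := by
  have h1 : FractionalIdeal.spanSingleton (𝓞 E)⁰ a * ((I⁻¹ : (FractionalIdeal (𝓞 E)⁰ E)ˣ) :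
      FractionalIdeal (𝓞 E)⁰ E) ≤ 1 := by
    rw [← Units.mul_inv I]
    gcongr
    rwa [FractionalIdeal.spanSingleton_le_iff_mem]
  obtain ⟨J, hJ⟩ := FractionalIdeal.le_one_iff_exists_coeIdeal.mp h1
  refine ⟨J, ?_⟩
  rw [hJ, mul_assoc, Units.inv_mul, mul_one]

variable (ι : E →+* ℂ) (d : ℕ) (hd : 0 < d)
    (hdeg : Module.finrank ℚ E = 2) (hdisc : NumberField.discr E = -(d : ℤ))
include ι hd hdeg hdisc

theorem norm_of_ideal (I : (FractionalIdeal (𝓞 E)⁰ E)ˣ) {a : E} {J : Ideal (𝓞 E)}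
    (h : FractionalIdeal.spanSingleton (𝓞 E)⁰ a = J * (I : FractionalIdeal (𝓞 E)⁰ E)) :
    ‖ι a‖ ^ 2 = (Ideal.absNorm J : ℝ) *
      (FractionalIdeal.absNorm (I : FractionalIdeal (𝓞 E)⁰ E) : ℝ) := by
  have h1 := congrArg FractionalIdeal.absNorm h
  rw [map_mul, FractionalIdeal.coeIdeal_absNorm, FractionalIdeal.absNorm_span_singleton] at h1
  have h2 := norm_eq_real ι d hd hdeg hdisc a
  have h3 : 0 ≤ Algebra.norm ℚ a := by
    have : (0:ℝ) ≤ ((Algebra.norm ℚ a : ℚ) : ℝ) := by rw [h2]; positivity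
    exact_mod_cast this
  rw [abs_of_nonneg h3] at h1
  rw [← h2, h1]
  push_cast; rfl

theorem norm_mem_int (I : (FractionalIdeal (𝓞 E)⁰ E)ˣ) {a : E}
    (ha : a ∈ (I : FractionalIdeal (𝓞 E)⁰ E)) :
    ∃ m : ℤ, ‖ι a‖ ^ 2 = (m : ℝ) *
      (FractionalIdeal.absNorm (I : FractionalIdeal (𝓞 E)⁰ E) : ℝ) := by
  obtain ⟨J, hJ⟩ := exists_ideal I ha
  exact ⟨(Ideal.absNorm J : ℕ), by rw [norm_of_ideal ι d hd hdeg hdisc I hJ]; simp⟩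

theorem conj_mem_inv (I : (FractionalIdeal (𝓞 E)⁰ E)ˣ) {a : E}
    (ha : a ∈ (I : FractionalIdeal (𝓞 E)⁰ E)) :
    sig a / algebraMap ℚ E (FractionalIdeal.absNorm (I : FractionalIdeal (𝓞 E)⁰ E)) ∈
      ((I⁻¹ : (FractionalIdeal (𝓞 E)⁰ E)ˣ) : FractionalIdeal (𝓞 E)⁰ E) := by
  rw [Units.val_inv_eq_inv_val, FractionalIdeal.mem_inv_iff I.ne_zero]
  intro b hb
  set N := FractionalIdeal.absNorm (I : FractionalIdeal (𝓞 E)⁰ E) with hN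
  have hNpos : 0 < N := absNorm_unit_pos I
  have hNR : (0:ℝ) < (N : ℝ) := by exact_mod_cast hNpos
  set z := sig a / algebraMap ℚ E N * b with hz
  have hιz : ι z = conj (ι a) * ι b / (N : ℝ) := by
    rw [hz, map_mul, map_div₀, sig_eq ι d hd hdeg hdisc]
    simp; ring
  obtain ⟨m1, h1⟩ := norm_mem_int ι d hd hdeg hdisc I ha
  obtain ⟨m2, h2⟩ := norm_mem_int ι d hd hdeg hdisc I hb
  obtain ⟨m3, h3⟩ := norm_mem_int ι d hd hdeg hdisc I
    ((I : FractionalIdeal (𝓞 E)⁰ E).coeToSubmodule.add_mem ha hb)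
  rw [← hN] at h1 h2 h3
  have toC : ∀ (x : E) (m : ℤ), ‖ι x‖ ^ 2 = (m : ℝ) * (N : ℝ) →
      ι x * conj (ι x) = (m : ℂ) * ((N : ℝ) : ℂ) := by
    intro x m hx
    rw [Complex.mul_conj, Complex.normSq_eq_norm_sq, hx]; push_cast; rfl
  have h1' := toC _ _ h1
  have h2' := toC _ _ h2
  have h3' := toC _ _ h3
  have hNC : ((N : ℝ) : ℂ) ≠ 0 := by exact_mod_cast hNR.ne'
  have htr : ι z + conj (ι z) = ((m3 - m1 - m2 : ℤ) : ℂ) := by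
    rw [hιz]
    simp only [map_div₀, map_mul, Complex.conj_conj, Complex.conj_ofReal]
    field_simp
    rw [map_add, map_add] at h3'
    push_cast
    linear_combination h3' - h1' - h2'
  have hnm : ι z * conj (ι z) = ((m1 * m2 : ℤ) : ℂ) := by
    rw [hιz]
    simp only [map_div₀, map_mul, Complex.conj_conj, Complex.conj_ofReal]
    field_simp
    push_cast
    linear_combination (ι b * conj (ι b)) * h1' + ((m1 : ℂ) * ((N : ℝ) : ℂ)) * h2'
  have hzint : IsIntegral ℤ z := by
    refine ⟨Polynomial.X ^ 2 - Polynomial.C (m3 - m1 - m2) * Polynomial.X +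
      Polynomial.C (m1 * m2), ?_, ?_⟩
    · monicity!
    · apply ι.injective
      simp only [Polynomial.eval₂_add, Polynomial.eval₂_sub, Polynomial.eval₂_mul,
        Polynomial.eval₂_pow, Polynomial.eval₂_X, Polynomial.eval₂_C]
      simp only [map_add, map_sub, map_mul, map_pow, map_zero, eq_intCast, map_intCast]
      push_cast at htr hnm ⊢
      linear_combination (ι z) * htr - hnm
  rw [FractionalIdeal.mem_one_iff]
  exact ⟨⟨z, hzint⟩, rfl⟩

theorem mem_inv_iff_conj (I : (FractionalIdeal (𝓞 E)⁰ E)ˣ) (z : ℂ) :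
    (∃ x : E, x ∈ ((I⁻¹ : (FractionalIdeal (𝓞 E)⁰ E)ˣ) : FractionalIdeal (𝓞 E)⁰ E) ∧ ι x = z) ↔
    ∃ a : E, a ∈ (I : FractionalIdeal (𝓞 E)⁰ E) ∧
      z = conj (ι a) / ((FractionalIdeal.absNorm (I : FractionalIdeal (𝓞 E)⁰ E) : ℝ) : ℂ) := by
  have hNpos := absNorm_unit_pos I
  constructor
  · rintro ⟨x, hx, rfl⟩
    have := conj_mem_inv ι d hd hdeg hdisc I⁻¹ hx
    rw [inv_inv, absNorm_inv] at this
    refine ⟨_, this, ?_⟩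
    rw [map_div₀, sig_eq ι d hd hdeg hdisc]
    have : ((FractionalIdeal.absNorm (I : FractionalIdeal (𝓞 E)⁰ E) : ℚ) : ℂ) ≠ 0 := by
      exact_mod_cast hNpos.ne'
    simp
  · rintro ⟨a, ha, rfl⟩
    refine ⟨_, conj_mem_inv ι d hd hdeg hdisc I ha, ?_⟩
    rw [map_div₀, sig_eq ι d hd hdeg hdisc]
    simp

end
end CS
end

section
open NumberField
open scoped nonZeroDivisors ComplexConjugate
namespace CS

section
variable {E : Type*} [Field E] [NumberField E]
variable (ι : E →+* ℂ) (d : ℕ) (hd : 0 < d)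
    (hdeg : Module.finrank ℚ E = 2) (hdisc : NumberField.discr E = -(d : ℤ))

include hdeg hdisc in
theorem exists_basis0 (I : (FractionalIdeal (𝓞 E)⁰ E)ˣ) :
    ∃ b : Fin 2 → E, (∀ x : E, x ∈ (I : FractionalIdeal (𝓞 E)⁰ E) ↔
      ∃ m n : ℤ, x = m * b 0 + n * b 1) ∧
      Algebra.discr ℚ b =
        (FractionalIdeal.absNorm (I : FractionalIdeal (𝓞 E)⁰ E)) ^ 2 * (-(d : ℚ)) := by
  classical
  have c1 : Fintype.card (Module.Free.ChooseBasisIndex ℤ I) = 2 := by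
    rw [← Module.finrank_eq_card_chooseBasisIndex, fractionalIdeal_rank, RingOfIntegers.rank, hdeg]
  have c2 : Fintype.card (Module.Free.ChooseBasisIndex ℤ (𝓞 E)) = 2 := by
    rw [← Module.finrank_eq_card_chooseBasisIndex, RingOfIntegers.rank, hdeg]
  let e1 : Module.Free.ChooseBasisIndex ℤ I ≃ Fin 2 := Fintype.equivFinOfCardEq c1
  let e : Module.Free.ChooseBasisIndex ℤ (𝓞 E) ≃ Module.Free.ChooseBasisIndex ℤ I :=
    Fintype.equivOfCardEq (c2.trans c1.symm)
  refine ⟨(basisOfFractionalIdeal E I) ∘ e1.symm, ?_, ?_⟩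
  · intro x
    have := mem_span_basisOfFractionalIdeal E (I := I) (x := x)
    rw [SetLike.mem_coe] at this
    rw [← this, ← e1.symm.surjective.range_comp]
    rw [Submodule.mem_span_range_iff_exists_fun]
    constructor
    · rintro ⟨c, hc⟩
      refine ⟨c 0, c 1, ?_⟩
      rw [← hc, Fin.sum_univ_two]; simp [zsmul_eq_mul]
    · rintro ⟨m, n, hmn⟩
      refine ⟨![m, n], ?_⟩
      rw [hmn, Fin.sum_univ_two]; simp [zsmul_eq_mul]
  · have h1 := det_basisOfFractionalIdeal_eq_absNorm E I e
    rw [Algebra.discr_reindex, ← Algebra.discr_reindex ℚ (basisOfFractionalIdeal E I) e.symm,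
      ← Module.Basis.coe_reindex]
    rw [← Module.Basis.toMatrix_map_vecMul (integralBasis E)
      ((basisOfFractionalIdeal E I).reindex e.symm), Algebra.discr_of_matrix_vecMul,
      ← NumberField.coe_discr, hdisc, ← Module.Basis.det_apply, ← sq_abs, h1]
    push_cast; rfl

include hd hdeg hdisc

/-- An oriented basis of a fractional ideal. -/
theorem exists_basis (I : (FractionalIdeal (𝓞 E)⁰ E)ˣ) :
    ∃ (a b : E), (∀ x : E, x ∈ (I : FractionalIdeal (𝓞 E)⁰ E) ↔
      ∃ m n : ℤ, x = m * a + n * b) ∧ ι b ≠ 0 ∧ 0 < (ι a / ι b).im ∧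
      ‖ι b‖ ^ 2 * (ι a / ι b).im =
        (FractionalIdeal.absNorm (I : FractionalIdeal (𝓞 E)⁰ E) : ℝ) * Real.sqrt d / 2 := by
  obtain ⟨b, hb, hdis⟩ := exists_basis0 d hdeg hdisc I
  have hN := absNorm_unit_pos I
  set N := FractionalIdeal.absNorm (I : FractionalIdeal (𝓞 E)⁰ E)
  have hNR : (0:ℝ) < (N : ℝ) := by exact_mod_cast hN
  have hdR : (0:ℝ) < d := by exact_mod_cast hd
  have h1 := discr_eq ι d hd hdeg hdisc b
  rw [hdis] at h1
  have key : (2 * (ι (b 0) * conj (ι (b 1))).im) ^ 2 = ((N : ℝ) * Real.sqrt d) ^ 2 := by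
    have h2 : ι (b 0) * conj (ι (b 1)) - ι (b 1) * conj (ι (b 0)) =
        ((2 * (ι (b 0) * conj (ι (b 1))).im : ℝ) : ℂ) * Complex.I := by
      apply Complex.ext <;> simp <;> ring
    rw [h2, mul_pow, Complex.I_sq] at h1
    rw [mul_pow (N : ℝ), Real.sq_sqrt hdR.le]
    have : (((N:ℝ) ^ 2 * d : ℝ) : ℂ) = (((2 * (ι (b 0) * conj (ι (b 1))).im) ^ 2 : ℝ) : ℂ) := by
      push_cast at h1 ⊢
      linear_combination -h1
    exact_mod_cast this.symm
  have pos : 0 < (N : ℝ) * Real.sqrt d := by positivity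
  have fin : ∀ u v : ℂ, 2 * (u * conj v).im = (N : ℝ) * Real.sqrt d →
      v ≠ 0 ∧ 0 < (u / v).im ∧ ‖v‖ ^ 2 * (u / v).im = (N : ℝ) * Real.sqrt d / 2 := by
    intro u v huv
    have hv : v ≠ 0 := by
      rintro rfl
      simp at huv; linarith [huv, pos, show (N:ℝ) * Real.sqrt d = 0 from by simp [huv]]
    have hv' : 0 < ‖v‖ ^ 2 := by positivity
    have h3 : ‖v‖ ^ 2 * (u / v).im = (u * conj v).im := by
      have : u * conj v = ((‖v‖ ^ 2 : ℝ) : ℂ) * (u / v) := by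
        rw [← Complex.normSq_eq_norm_sq, Complex.normSq_eq_conj_mul_self]; field_simp
      rw [this, Complex.im_ofReal_mul]
    have h4 : ‖v‖ ^ 2 * (u / v).im = (N : ℝ) * Real.sqrt d / 2 := by rw [h3]; linarith
    refine ⟨hv, ?_, h4⟩
    have : 0 < ‖v‖ ^ 2 * (u / v).im := by rw [h4]; linarith
    exact (mul_pos_iff_of_pos_left hv').mp this
  rcases sq_eq_sq_iff_eq_or_eq_neg.mp key with h | h
  · exact ⟨b 0, b 1, hb, fin _ _ h⟩
  · refine ⟨b 1, b 0, ?_, fin _ _ ?_⟩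
    · intro x; rw [hb]
      exact ⟨fun ⟨m, n, h⟩ => ⟨n, m, by rw [h, add_comm]⟩, fun ⟨m, n, h⟩ => ⟨n, m, by rw [h, add_comm]⟩⟩
    · have : (ι (b 1) * conj (ι (b 0))).im = - (ι (b 0) * conj (ι (b 1))).im := by simp; ring
      rw [this]; linarith

omit hd hdeg hdisc in
theorem Delta_conj (τ : ℂ) : RamanujanDelta (-conj τ) = conj (RamanujanDelta τ) := by
  have hexp : ∀ c : ℂ, conj c = c → Complex.exp (2 * Real.pi * Complex.I * c * (-conj τ)) =
      conj (Complex.exp (2 * Real.pi * Complex.I * c * τ)) := by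
    intro c hc
    rw [← Complex.exp_conj]
    simp only [map_mul, Complex.conj_I, Complex.conj_ofReal, hc, Complex.conj_ofNat]
    congr 1; ring
  have hf : ∀ n : ℕ, (1 - Complex.exp (2 * Real.pi * Complex.I * ((n : ℂ) + 1) * (-conj τ))) ^ 24 =
      conj ((1 - Complex.exp (2 * Real.pi * Complex.I * ((n : ℂ) + 1) * τ)) ^ 24) := by
    intro n
    rw [hexp _ (by simp), map_pow, map_sub, map_one]
  have hp := Function.LeftInverse.map_tprod (L := SummationFilter.unconditional ℕ)
    (fun n : ℕ => (1 - Complex.exp (2 * Real.pi * Complex.I * ((n : ℂ) + 1) * τ)) ^ 24)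
    (g := starRingEnd ℂ) Complex.continuous_conj Complex.continuous_conj
    (fun z => Complex.conj_conj z)
  have h0 := hexp 1 (by simp)
  rw [mul_one] at h0
  unfold RamanujanDelta
  rw [map_mul, hp, h0, tprod_congr hf]

theorem D_mul (D : FractionalIdeal (𝓞 E)⁰ E → ℂ)
    (hD : ∀ (𝔞 : FractionalIdeal (𝓞 E)⁰ E) (ω₁ ω₂ : ℂ), ω₂ ≠ 0 → 0 < (ω₁ / ω₂).im →
      (∀ z : ℂ, (∃ x : E, x ∈ 𝔞 ∧ ι x = z) ↔ ∃ m n : ℤ, z = m * ω₁ + n * ω₂) →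
      D 𝔞 = ω₂ ^ (-12 : ℤ) * RamanujanDelta (ω₁ / ω₂))
    (I : (FractionalIdeal (𝓞 E)⁰ E)ˣ) (a b : E)
    (hmem : ∀ x : E, x ∈ (I : FractionalIdeal (𝓞 E)⁰ E) ↔ ∃ m n : ℤ, x = m * a + n * b)
    (hb : ι b ≠ 0) (him : 0 < (ι a / ι b).im)
    (hcov : ‖ι b‖ ^ 2 * (ι a / ι b).im =
        (FractionalIdeal.absNorm (I : FractionalIdeal (𝓞 E)⁰ E) : ℝ) * Real.sqrt d / 2) :
    D (I : FractionalIdeal (𝓞 E)⁰ E) *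
      D ((I⁻¹ : (FractionalIdeal (𝓞 E)⁰ E)ˣ) : FractionalIdeal (𝓞 E)⁰ E) =
      (((2 * (ι a / ι b).im / Real.sqrt d) ^ 12 * ‖RamanujanDelta (ι a / ι b)‖ ^ 2 : ℝ) : ℂ) := by
  have hN := absNorm_unit_pos I
  have hinv := mem_inv_iff_conj ι d hd hdeg hdisc I
  set N := FractionalIdeal.absNorm (I : FractionalIdeal (𝓞 E)⁰ E)
  have hNR : (0:ℝ) < (N : ℝ) := by exact_mod_cast hN
  have hNC : ((N : ℝ) : ℂ) ≠ 0 := by exact_mod_cast hNR.ne'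
  have hdR : (0:ℝ) < d := by exact_mod_cast hd
  have hsd : 0 < Real.sqrt d := by positivity
  have h1 := hD I (ι a) (ι b) hb him (by
    intro z
    constructor
    · rintro ⟨x, hx, rfl⟩
      obtain ⟨m, n, rfl⟩ := (hmem x).mp hx
      exact ⟨m, n, by simp⟩
    · rintro ⟨m, n, rfl⟩
      exact ⟨_, (hmem _).mpr ⟨m, n, rfl⟩, by simp⟩)
  have hcb : conj (ι b) ≠ 0 := by simpa using hb
  have hq : (-(conj (ι a)) / ((N : ℝ) : ℂ)) / (conj (ι b) / ((N : ℝ) : ℂ)) = - conj (ι a / ι b) := by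
    rw [map_div₀]; field_simp
  have h2 := hD ((I⁻¹ : (FractionalIdeal (𝓞 E)⁰ E)ˣ) : FractionalIdeal (𝓞 E)⁰ E)
    (-(conj (ι a)) / ((N : ℝ) : ℂ)) (conj (ι b) / ((N : ℝ) : ℂ)) (div_ne_zero hcb hNC)
    (by rw [hq, Complex.neg_im, Complex.conj_im, neg_neg]; exact him) (by
    intro z
    rw [hinv]
    constructor
    · rintro ⟨x, hx, rfl⟩
      obtain ⟨m, n, rfl⟩ := (hmem x).mp hx
      refine ⟨-m, n, ?_⟩
      simp only [map_add, map_mul, map_intCast]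
      push_cast; ring
    · rintro ⟨m, n, rfl⟩
      refine ⟨_, (hmem _).mpr ⟨-m, n, rfl⟩, ?_⟩
      simp only [map_add, map_mul, map_intCast]
      push_cast; ring)
  rw [h1, h2, hq, Delta_conj]
  have e1 : ((‖RamanujanDelta (ι a / ι b)‖ ^ 2 : ℝ) : ℂ) =
      RamanujanDelta (ι a / ι b) * conj (RamanujanDelta (ι a / ι b)) := by
    rw [Complex.mul_conj, Complex.normSq_eq_norm_sq]
  have e2 : (2 * (ι a / ι b).im / Real.sqrt d) = (N : ℝ) / ‖ι b‖ ^ 2 := by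
    have : 0 < ‖ι b‖ ^ 2 := by positivity
    field_simp
    linarith
  have e3 : ((‖ι b‖ ^ 2 : ℝ) : ℂ) = ι b * conj (ι b) := by
    rw [Complex.mul_conj, Complex.normSq_eq_norm_sq]
  rw [e2, Complex.ofReal_mul, e1, Complex.ofReal_pow, Complex.ofReal_div, e3]
  generalize RamanujanDelta (ι a / ι b) = X
  rw [zpow_neg, zpow_neg]
  have hz : ∀ z : ℂ, z ^ (12 : ℤ) = z ^ 12 := fun z => by norm_cast
  rw [hz, hz, div_pow, div_pow, mul_pow]
  field_simp
end
end CS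
end

section
open NumberField
open scoped nonZeroDivisors ComplexConjugate
namespace CS

section
variable {E : Type*} [Field E] [NumberField E]

theorem exists_pair (rep : ClassGroup (𝓞 E) → (FractionalIdeal (𝓞 E)⁰ E)ˣ)
    (hrep : ∀ C, ClassGroup.mk E (rep C) = C) (J : Ideal (𝓞 E)) (hJ : J ≠ ⊥) :
    ∃ p : ClassGroup (𝓞 E) × E, p.2 ∈ (rep p.1 : FractionalIdeal (𝓞 E)⁰ E) ∧ p.2 ≠ 0 ∧
      FractionalIdeal.spanSingleton (𝓞 E)⁰ p.2 = J * (rep p.1 : FractionalIdeal (𝓞 E)⁰ E) := by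
  let Ju : (FractionalIdeal (𝓞 E)⁰ E)ˣ := Units.mk0 (J : FractionalIdeal (𝓞 E)⁰ E)
    (FractionalIdeal.coeIdeal_ne_zero.mpr hJ)
  have h1 : ClassGroup.mk E (Ju * rep (ClassGroup.mk E Ju)⁻¹) = 1 := by
    rw [map_mul, hrep, mul_inv_cancel]
  rw [ClassGroup.mk_eq_one_iff, FractionalIdeal.isPrincipal_iff] at h1
  obtain ⟨x, hx⟩ := h1
  refine ⟨⟨(ClassGroup.mk E Ju)⁻¹, x⟩, ?_, ?_, hx.symm⟩
  · rw [← FractionalIdeal.spanSingleton_le_iff_mem, ← hx, Units.val_mul]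
    exact mul_le_of_le_one_left' FractionalIdeal.coeIdeal_le_one
  · rintro rfl
    rw [FractionalIdeal.spanSingleton_zero] at hx
    exact (Ju * rep (ClassGroup.mk E Ju)⁻¹).ne_zero hx

theorem class_unique (rep : ClassGroup (𝓞 E) → (FractionalIdeal (𝓞 E)⁰ E)ˣ)
    (hrep : ∀ C, ClassGroup.mk E (rep C) = C) (J : Ideal (𝓞 E)) (hJ : J ≠ ⊥)
    (C : ClassGroup (𝓞 E)) (x : E)
    (h : FractionalIdeal.spanSingleton (𝓞 E)⁰ x = J * (rep C : FractionalIdeal (𝓞 E)⁰ E)) :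
    C = (ClassGroup.mk E (Units.mk0 (J : FractionalIdeal (𝓞 E)⁰ E)
      (FractionalIdeal.coeIdeal_ne_zero.mpr hJ)))⁻¹ := by
  apply eq_inv_of_mul_eq_one_right
  rw [← hrep C]
  rw [← map_mul, ClassGroup.mk_eq_one_iff, FractionalIdeal.isPrincipal_iff]
  exact ⟨x, h.symm⟩

theorem card_units (ι : E →+* ℂ) (d : ℕ) (hd : 0 < d)
    (hdeg : Module.finrank ℚ E = 2) (hdisc : NumberField.discr E = -(d : ℤ)) :
    Finite (𝓞 E)ˣ ∧ Nat.card (𝓞 E)ˣ = Nat.card (NumberField.Units.torsion E) := by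
  have htop : NumberField.Units.torsion E = ⊤ := by
    rw [eq_top_iff]
    intro u _
    rw [NumberField.Units.mem_torsion]
    intro v
    have h1 := norm_eq_real v.embedding d hd hdeg hdisc (u : E)
    have h2 : |(RingOfIntegers.norm ℚ (u : 𝓞 E) : ℚ)| = 1 :=
      NumberField.isUnit_iff_norm.mp u.isUnit
    rw [RingOfIntegers.coe_norm] at h2
    rw [← InfinitePlace.norm_embedding_eq]
    have h3 : |((Algebra.norm ℚ (u : E) : ℚ) : ℝ)| = 1 := by exact_mod_cast h2
    rw [h1, abs_of_nonneg (by positivity)] at h3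
    exact (pow_eq_one_iff_of_nonneg (norm_nonneg _) two_ne_zero).mp h3
  have hc : Nat.card (𝓞 E)ˣ = Nat.card (NumberField.Units.torsion E) := by
    rw [htop, Subgroup.card_top]
  refine ⟨?_, hc⟩
  apply Nat.finite_of_card_ne_zero
  rw [hc]
  exact ne_of_gt Nat.card_pos

/-- pairs `(J, u)` correspond to generators -/
theorem exists_equiv (rep : ClassGroup (𝓞 E) → (FractionalIdeal (𝓞 E)⁰ E)ˣ)
    (hrep : ∀ C, ClassGroup.mk E (rep C) = C) :
    ∃ e : ({J : Ideal (𝓞 E) // J ≠ ⊥} × (𝓞 E)ˣ) ≃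
      {p : ClassGroup (𝓞 E) × E // p.2 ∈ (rep p.1 : FractionalIdeal (𝓞 E)⁰ E) ∧ p.2 ≠ 0},
      ∀ q, FractionalIdeal.spanSingleton (𝓞 E)⁰ (e q).1.2 =
        (q.1.1 : FractionalIdeal (𝓞 E)⁰ E) * (rep (e q).1.1 : FractionalIdeal (𝓞 E)⁰ E) := by
  choose f hf1 hf2 hf3 using exists_pair rep hrep
  have hspan : ∀ (J : Ideal (𝓞 E)) (hJ : J ≠ ⊥) (u : (𝓞 E)ˣ),
      FractionalIdeal.spanSingleton (𝓞 E)⁰ (u • (f J hJ).2) =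
        J * (rep (f J hJ).1 : FractionalIdeal (𝓞 E)⁰ E) := by
    intro J hJ u
    rw [← hf3, eq_comm, FractionalIdeal.spanSingleton_eq_spanSingleton]
    exact ⟨u, rfl⟩
  let Φ : ({J : Ideal (𝓞 E) // J ≠ ⊥} × (𝓞 E)ˣ) →
      {p : ClassGroup (𝓞 E) × E // p.2 ∈ (rep p.1 : FractionalIdeal (𝓞 E)⁰ E) ∧ p.2 ≠ 0} :=
    fun q => ⟨((f q.1.1 q.1.2).1, q.2 • (f q.1.1 q.1.2).2),
      (rep (f q.1.1 q.1.2).1 : FractionalIdeal (𝓞 E)⁰ E).coeToSubmodule.smul_mem _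
        (hf1 q.1.1 q.1.2), by
        change q.2 • (f q.1.1 q.1.2).2 ≠ 0
        rw [Ne, smul_eq_zero_iff_eq]; exact hf2 _ _⟩
  have hΦ : Function.Bijective Φ := by
    constructor
    · rintro ⟨⟨J, hJ⟩, u⟩ ⟨⟨J', hJ'⟩, u'⟩ h
      have h1 : (f J hJ).1 = (f J' hJ').1 := congrArg (fun p => p.1.1) h
      have h2 : u • (f J hJ).2 = u' • (f J' hJ').2 := congrArg (fun p => p.1.2) h
      have h3 := hspan J hJ u
      rw [h2, h1, hspan J' hJ' u'] at h3
      have h4 : J' = J := by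
        have := mul_right_cancel₀ (rep (f J' hJ').1).ne_zero h3
        exact FractionalIdeal.coeIdeal_injective this
      subst h4
      have h5 : u = u' := by
        rw [Units.smul_def, Units.smul_def, Algebra.smul_def, Algebra.smul_def] at h2
        have := mul_right_cancel₀ (hf2 _ _) h2
        exact Units.ext (FaithfulSMul.algebraMap_injective (𝓞 E) E this)
      rw [h5]
    · rintro ⟨⟨C, x⟩, hx, hx0⟩
      simp only at hx hx0
      obtain ⟨J, hJ⟩ := exists_ideal (rep C) hx
      have hJ0 : J ≠ ⊥ := by
        rintro rfl
        rw [FractionalIdeal.coeIdeal_bot, zero_mul, FractionalIdeal.spanSingleton_eq_zero_iff] at hJ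
        exact hx0 hJ
      have hC : C = (f J hJ0).1 := by
        rw [class_unique rep hrep J hJ0 C x hJ,
          class_unique rep hrep J hJ0 (f J hJ0).1 (f J hJ0).2 (hf3 J hJ0)]
      have h3 := hf3 J hJ0
      rw [← hC, ← hJ, FractionalIdeal.spanSingleton_eq_spanSingleton] at h3
      obtain ⟨u, hu⟩ := h3
      refine ⟨⟨⟨J, hJ0⟩, u⟩, ?_⟩
      apply Subtype.ext
      exact Prod.ext hC.symm hu
  exact ⟨Equiv.ofBijective Φ hΦ, fun q => hspan q.1.1 q.1.2 q.2⟩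

end
end CS
end

section
open NumberField
open scoped nonZeroDivisors ComplexConjugate
namespace CS

section
variable {E : Type*} [Field E] [NumberField E]
variable (ι : E →+* ℂ) (d : ℕ) (hd : 0 < d)
    (hdeg : Module.finrank ℚ E = 2) (hdisc : NumberField.discr E = -(d : ℤ))

include hd hdeg hdisc

/-- The sum over one class. -/
theorem class_hasSum (I : (FractionalIdeal (𝓞 E)⁰ E)ˣ) (a b : E)
    (hmem : ∀ x : E, x ∈ (I : FractionalIdeal (𝓞 E)⁰ E) ↔ ∃ m n : ℤ, x = m * a + n * b)
    (hb : ι b ≠ 0) (him : 0 < (ι a / ι b).im)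
    (hcov : ‖ι b‖ ^ 2 * (ι a / ι b).im =
        (FractionalIdeal.absNorm (I : FractionalIdeal (𝓞 E)⁰ E) : ℝ) * Real.sqrt d / 2)
    {s : ℂ} (hs : 1 < s.re) :
    HasSum (fun x : {x : E // x ∈ (I : FractionalIdeal (𝓞 E)⁰ E) ∧ x ≠ 0} =>
      1 / ((‖ι x.1‖ ^ 2 / (FractionalIdeal.absNorm (I : FractionalIdeal (𝓞 E)⁰ E) : ℝ) : ℝ) : ℂ) ^ s)
      (((2 / Real.sqrt d : ℝ) : ℂ) ^ s * Ep (ι a / ι b).re (ι a / ι b).im s) := by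
  have hN := absNorm_unit_pos I
  set N := FractionalIdeal.absNorm (I : FractionalIdeal (𝓞 E)⁰ E)
  have hNR : (0:ℝ) < (N : ℝ) := by exact_mod_cast hN
  have hdR : (0:ℝ) < d := by exact_mod_cast hd
  have hsd : 0 < Real.sqrt d := by positivity
  set x := (ι a / ι b).re with hx
  set y := (ι a / ι b).im with hy
  have hb2 : 0 < ‖ι b‖ ^ 2 := by positivity
  have hs0 : s ≠ 0 := by rintro rfl; simp at hs; linarith
  have hτ : (⟨x, y⟩ : ℂ) = ι a / ι b := rfl
  have hnorm : ∀ p : ℤ × ℤ, ‖ι (p.1 * a + p.2 * b)‖ ^ 2 = ‖ι b‖ ^ 2 * Q x y p := by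
    intro p
    rw [Q_eq_normSq, hτ, ← mul_pow, ← norm_mul]
    congr 2
    simp; field_simp
  have h1 := (Ep_hasSum (x := x) him hs).mul_left (((2 / Real.sqrt d : ℝ) : ℂ) ^ s)
  have hval : ∀ p : ℤ × ℤ, ((2 / Real.sqrt d : ℝ) : ℂ) ^ s * ((y : ℂ) ^ s * (1 / (Q x y p : ℂ) ^ s)) =
      1 / ((‖ι (p.1 * a + p.2 * b)‖ ^ 2 / (N : ℝ) : ℝ) : ℂ) ^ s := by
    intro p
    have e1 : ‖ι (p.1 * a + p.2 * b)‖ ^ 2 / (N : ℝ) = (2 / Real.sqrt d * y)⁻¹ * Q x y p := by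
      rw [hnorm]
      field_simp
      linear_combination 2 * Q x y p * hcov
    have hpos : 0 < 2 / Real.sqrt d * y := by positivity
    rw [e1, Complex.ofReal_mul, Complex.mul_cpow_ofReal_nonneg (by positivity) (Q_nonneg _ _ _),
      ← mul_assoc, ← Complex.mul_cpow_ofReal_nonneg (by positivity) him.le, ← Complex.ofReal_mul,
      Complex.ofReal_inv, Complex.inv_cpow _ _ (by
        rw [Complex.arg_ofReal_of_nonneg hpos.le]; exact Real.pi_pos.ne)]
    simp
    ring
  -- move to the subtype of nonzero pairs
  have hinj : ∀ p : ℤ × ℤ, ι (p.1 * a + p.2 * b) = 0 → p = 0 := by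
    intro p hp
    have := hnorm p
    rw [hp] at this
    rw [← Q_eq_zero_iff (x := x) him]
    simp at this
    rcases this with h | h
    · exact absurd h (by simpa using hb)
    · exact h
  let j : {p : ℤ × ℤ // p ≠ 0} → {x : E // x ∈ (I : FractionalIdeal (𝓞 E)⁰ E) ∧ x ≠ 0} :=
    fun p => ⟨p.1.1 * a + p.1.2 * b, (hmem _).mpr ⟨_, _, rfl⟩, fun h => p.2 (hinj _ (by rw [h, map_zero]))⟩
  have hj : Function.Bijective j := by
    constructor
    · rintro ⟨p, hp⟩ ⟨q, hq⟩ h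
      have h' : (p.1 : E) * a + p.2 * b = q.1 * a + q.2 * b := congrArg Subtype.val h
      have : p - q = 0 := by
        apply hinj
        rw [Prod.fst_sub, Prod.snd_sub]
        push_cast
        rw [show ((p.1 : E) - q.1) * a + (p.2 - q.2) * b = 0 by linear_combination h', map_zero]
      exact Subtype.ext (sub_eq_zero.mp this)
    · rintro ⟨z, hz, hz0⟩
      obtain ⟨m, n, rfl⟩ := (hmem z).mp hz
      refine ⟨⟨(m, n), ?_⟩, rfl⟩
      intro h
      apply hz0
      rw [Prod.mk_eq_zero] at h
      simp [h.1, h.2]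
  have h2 : HasSum (fun p : {p : ℤ × ℤ // p ≠ 0} =>
      1 / ((‖ι (p.1.1 * a + p.1.2 * b)‖ ^ 2 / (N : ℝ) : ℝ) : ℂ) ^ s)
      (((2 / Real.sqrt d : ℝ) : ℂ) ^ s * Ep x y s) := by
    rw [funext hval] at h1
    refine (hasSum_subtype_iff_of_support_subset (s := {p : ℤ × ℤ | p ≠ 0}) ?_).mpr h1
    intro p hp hp0
    apply hp
    change p = 0 at hp0
    subst hp0
    simp [hs0]
  exact (Equiv.hasSum_iff (Equiv.ofBijective j hj)).mp h2

theorem main_identity [NeZero d] (χ : DirichletCharacter ℤ d)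
    (hχquad : ∀ u : (ZMod d)ˣ, χ u = 1 ∨ χ u = -1)
    (hχ : ∀ p : ℕ, p.Prime → ¬ p ∣ d →
      (χ (p : ZMod d) = -1 ↔ (Ideal.span {(p : 𝓞 E)} : Ideal (𝓞 E)).IsPrime))
    (rep : ClassGroup (𝓞 E) → (FractionalIdeal (𝓞 E)⁰ E)ˣ)
    (hrep : ∀ C, ClassGroup.mk E (rep C) = C)
    (τ : ClassGroup (𝓞 E) → ℂ)
    (hτ : ∀ C, ∃ a b : E, τ C = ι a / ι b ∧
      (∀ x : E, x ∈ (rep C : FractionalIdeal (𝓞 E)⁰ E) ↔ ∃ m n : ℤ, x = m * a + n * b) ∧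
      ι b ≠ 0 ∧ 0 < (ι a / ι b).im ∧ ‖ι b‖ ^ 2 * (ι a / ι b).im =
        (FractionalIdeal.absNorm (rep C : FractionalIdeal (𝓞 E)⁰ E) : ℝ) * Real.sqrt d / 2)
    {s : ℂ} (hs : 1 < s.re) :
    (Nat.card (NumberField.Units.torsion E) : ℂ) *
      (riemannZeta s * DirichletCharacter.LFunction (chiC χ) s) =
    ∑ C : ClassGroup (𝓞 E), ((2 / Real.sqrt d : ℝ) : ℂ) ^ s * Ep (τ C).re (τ C).im s := by
  classical
  have hs0 : s ≠ 0 := by rintro rfl; simp at hs; linarith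
  obtain ⟨hfin, hcard⟩ := card_units ι d hd hdeg hdisc
  obtain ⟨e, he⟩ := exists_equiv rep hrep
  have h1 := ideal_hasSum E ((RingOfIntegers.rank E).trans hdeg) d hdisc χ hχquad hχ hs
  have h2 : HasSum (fun J : {J : Ideal (𝓞 E) // J ≠ ⊥} =>
      1 / ((Ideal.absNorm J.1 : ℕ) : ℂ) ^ s)
      (riemannZeta s * DirichletCharacter.LFunction (chiC χ) s) := by
    refine (hasSum_subtype_iff_of_support_subset (s := {J : Ideal (𝓞 E) | J ≠ ⊥}) ?_).mpr h1
    intro J hJ hJ0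
    apply hJ
    change J = ⊥ at hJ0
    subst hJ0
    simp [hs0]
  haveI := Fintype.ofFinite (𝓞 E)ˣ
  -- functions on pairs
  let g : ClassGroup (𝓞 E) × E → ℂ := fun p =>
    if p.2 ∈ (rep p.1 : FractionalIdeal (𝓞 E)⁰ E) ∧ p.2 ≠ 0 then
      1 / ((‖ι p.2‖ ^ 2 /
        (FractionalIdeal.absNorm (rep p.1 : FractionalIdeal (𝓞 E)⁰ E) : ℝ) : ℝ) : ℂ) ^ s else 0
  have h3 : HasSum (fun q : {J : Ideal (𝓞 E) // J ≠ ⊥} × (𝓞 E)ˣ =>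
      1 / ((Ideal.absNorm q.1.1 : ℕ) : ℂ) ^ s)
      ((Nat.card (NumberField.Units.torsion E) : ℂ) *
        (riemannZeta s * DirichletCharacter.LFunction (chiC χ) s)) := by
    have hu : HasSum (fun u : (𝓞 E)ˣ => (1 : ℂ)) (Nat.card (NumberField.Units.torsion E) : ℂ) := by
      rw [← hcard, Nat.card_eq_fintype_card]
      have := hasSum_fintype (fun u : (𝓞 E)ˣ => (1 : ℂ))
      simpa using this
    have hsm := summable_mul_of_summable_norm h2.summable.norm hu.summable.norm
    have := (h2.mul hu hsm)
    rw [mul_comm (riemannZeta s * _)] at this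
    exact this.congr_fun' (fun q => by simp)
  have hg : ∀ q, g (e q).1 = 1 / ((Ideal.absNorm q.1.1 : ℕ) : ℂ) ^ s := by
    intro q
    have hN := absNorm_unit_pos (rep (e q).1.1)
    have := norm_of_ideal ι d hd hdeg hdisc (rep (e q).1.1) (he q)
    simp only [g]
    rw [if_pos (e q).2, this, mul_div_cancel_right₀ _ (by exact_mod_cast hN.ne')]
    simp
  have h4 : HasSum g ((Nat.card (NumberField.Units.torsion E) : ℂ) *
        (riemannZeta s * DirichletCharacter.LFunction (chiC χ) s)) := by
    refine (hasSum_subtype_iff_of_support_subset (s := {p : ClassGroup (𝓞 E) × E |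
      p.2 ∈ (rep p.1 : FractionalIdeal (𝓞 E)⁰ E) ∧ p.2 ≠ 0}) ?_).mp ?_
    · intro p hp
      by_contra h
      apply hp
      simp only [g]
      exact if_neg h
    · refine (Equiv.hasSum_iff e).mp ?_
      exact h3.congr_fun' hg
  have h5 : ∀ C, HasSum (fun x : E => g (C, x))
      (((2 / Real.sqrt d : ℝ) : ℂ) ^ s * Ep (τ C).re (τ C).im s) := by
    intro C
    obtain ⟨a, b, hab, hm, hb, him, hcov⟩ := hτ C
    rw [hab]
    refine (hasSum_subtype_iff_of_support_subset (s := {x : E |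
      x ∈ (rep C : FractionalIdeal (𝓞 E)⁰ E) ∧ x ≠ 0}) ?_).mp ?_
    · intro p hp
      by_contra h
      apply hp
      simp only [g]
      exact if_neg h
    · refine (class_hasSum ι d hd hdeg hdisc (rep C) a b hm hb him hcov hs).congr_fun' ?_
      intro x
      simp only [g, Function.comp]
      exact if_pos x.2
  exact (h4.prod_fiberwise h5).unique (hasSum_fintype _)
end
end CS
end

section
open NumberField
open scoped nonZeroDivisors ComplexConjugate Topology
namespace CS

section

theorem L_deriv {d : ℕ} [NeZero d] (hd1 : 2 < d) (χ : DirichletCharacter ℤ d) (hne : χ ≠ 1) :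
    HasDerivAt (DirichletCharacter.LFunction (chiC χ))
      (-(Real.log d : ℂ) * DirichletCharacter.LFunction (chiC χ) 0 +
        ((∑ a ∈ Finset.Ioo 0 d, ((χ (a : ZMod d) : ℤ) : ℝ) * Real.log (Real.Gamma (a / d)) : ℝ) : ℂ)) 0 := by
  have hd0 : (d : ℂ) ≠ 0 := by exact_mod_cast (NeZero.ne d)
  have : Fact (1 < d) := ⟨by omega⟩
  have : Nontrivial (ZMod d) := ZMod.nontrivial d
  have hneC : chiC χ ≠ 1 := by
    rw [chiC, MulChar.ringHomComp_ne_one_iff (RingHom.injective_int _)]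
    exact hne
  have hsum : ∑ j : ZMod d, chiC χ j = 0 := MulChar.sum_eq_zero_of_ne_one hneC
  have hpow : HasDerivAt (fun s : ℂ => (d : ℂ) ^ (-s)) (-(Real.log d : ℂ)) 0 := by
    have := ((hasDerivAt_id (0 : ℂ)).neg).const_cpow (c := (d : ℂ)) (Or.inl hd0)
    have h2 : (d : ℂ) ^ (-(id (0:ℂ))) * Complex.log d * -1 = -(Real.log d : ℂ) := by
      rw [Complex.ofReal_log (Nat.cast_nonneg d)]; simp
    rw [← h2]; exact this
  have hH : ∀ j : ZMod d, HasDerivAt (fun s : ℂ => chiC χ j * HurwitzZeta.hurwitzZeta (ZMod.toAddCircle j) s)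
      (chiC χ j * deriv (HurwitzZeta.hurwitzZeta (ZMod.toAddCircle j)) 0) 0 := fun j =>
    ((HurwitzZeta.differentiableAt_hurwitzZeta _ (by norm_num)).hasDerivAt).const_mul _
  have hS := HasDerivAt.fun_sum (u := Finset.univ) (fun j _ => hH j)
  have hL := hpow.mul hS
  have hfun : DirichletCharacter.LFunction (chiC χ) = fun s : ℂ => (d : ℂ) ^ (-s) *
      ∑ j : ZMod d, chiC χ j * HurwitzZeta.hurwitzZeta (ZMod.toAddCircle j) s := rfl
  have h0 : DirichletCharacter.LFunction (chiC χ) 0 =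
      ∑ j : ZMod d, chiC χ j * HurwitzZeta.hurwitzZeta (ZMod.toAddCircle j) 0 := by
    rw [hfun]; simp
  rw [h0]
  have hval : ∑ j : ZMod d, chiC χ j * deriv (HurwitzZeta.hurwitzZeta (ZMod.toAddCircle j)) 0 =
      ((∑ a ∈ Finset.Ioo 0 d, ((χ (a : ZMod d) : ℤ) : ℝ) * Real.log (Real.Gamma (a / d)) : ℝ) : ℂ) := by
    have h1 : ∀ j : ZMod d, chiC χ j * deriv (HurwitzZeta.hurwitzZeta (ZMod.toAddCircle j)) 0 =
        chiC χ j * deriv riemannZeta 0 + chiC χ j * (Real.log (Real.Gamma (j.val / d)) : ℂ) := by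
      intro j
      rcases eq_or_ne j 0 with rfl | hj
      · simp [MulChar.map_zero]
      · rw [← mul_add, ← lerch]
        · rw [ZMod.toAddCircle_apply]
        · have : 0 < j.val := ZMod.val_pos.mpr hj
          have : 0 < d := by omega
          positivity
        · rw [div_le_one (by exact_mod_cast (by omega : 0 < d))]
          exact_mod_cast (ZMod.val_lt j).le
    rw [Finset.sum_congr rfl (fun j _ => h1 j), Finset.sum_add_distrib, ← Finset.sum_mul, hsum,
      zero_mul, zero_add]
    have h2 : ∑ j : ZMod d, chiC χ j * (Real.log (Real.Gamma (j.val / d)) : ℂ) =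
        ∑ a ∈ Finset.range d, chiC χ (a : ZMod d) * (Real.log (Real.Gamma (a / d)) : ℂ) := by
      symm
      apply Finset.sum_bij (fun (a : ℕ) _ => (a : ZMod d))
      · simp
      · intro a ha b hb h
        rw [Finset.mem_range] at ha hb
        have := congrArg ZMod.val h
        rwa [ZMod.val_natCast_of_lt ha, ZMod.val_natCast_of_lt hb] at this
      · intro j _
        exact ⟨j.val, by simpa using ZMod.val_lt j, by simp⟩
      · intro a ha
        rw [Finset.mem_range] at ha
        rw [ZMod.val_natCast_of_lt ha]
    rw [h2]
    push_cast
    symm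
    have h3 : ∀ a : ℕ, ((χ (a : ZMod d) : ℤ) : ℂ) * (Real.log (Real.Gamma (a / d)) : ℂ) =
        chiC χ (a : ZMod d) * (Real.log (Real.Gamma (a / d)) : ℂ) := fun a => by rw [chiC_apply]
    rw [Finset.sum_congr rfl (fun a _ => h3 a)]
    apply Finset.sum_subset
    · intro a ha
      rw [Finset.mem_Ioo] at ha; rw [Finset.mem_range]; exact ha.2
    · intro a ha ha'
      rw [Finset.mem_range] at ha; rw [Finset.mem_Ioo] at ha'
      have : a = 0 := by omega
      subst this
      simp [MulChar.map_zero]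
  rw [← hval, hfun]
  have e : (d : ℂ) ^ (-(0 : ℂ)) = 1 := by simp
  rw [e, one_mul] at hL
  exact hL
end
end CS
end

section
open NumberField
open scoped nonZeroDivisors ComplexConjugate Topology
namespace CS

section

/-- Analytic continuation of the class number identity to `s = 0`. -/
theorem at_zero {d : ℕ} [NeZero d] (hd1 : 2 < d) (χ : DirichletCharacter ℤ d) (hne : χ ≠ 1)
    {T : Type*} [Fintype T] (τ : T → ℂ) (hτ : ∀ C, 0 < (τ C).im) (w : ℕ)
    (hid : ∀ s : ℂ, 1 < s.re → (w : ℂ) *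
      (riemannZeta s * DirichletCharacter.LFunction (chiC χ) s) =
      ∑ C : T, ((2 / Real.sqrt d : ℝ) : ℂ) ^ s * Ep (τ C).re (τ C).im s) :
    6 * (w : ℝ) * ∑ a ∈ Finset.Ioo 0 d, ((χ (a : ZMod d) : ℤ) : ℝ) * Real.log (Real.Gamma (a / d)) =
    ∑ C : T, (12 * Real.log (2 * Real.pi * d) + (12 * Real.log (2 * (τ C).im / Real.sqrt d) +
      2 * Real.log ‖RamanujanDelta (τ C)‖)) := by
  have hdR : (0:ℝ) < d := by exact_mod_cast (by omega : 0 < d)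
  have hsd : 0 < Real.sqrt d := by positivity
  have hc : 0 < 2 / Real.sqrt d := by positivity
  have hcC : ((2 / Real.sqrt d : ℝ) : ℂ) ≠ 0 := by exact_mod_cast hc.ne'
  set c : ℝ := 2 / Real.sqrt d with hcdef
  have hneC : chiC χ ≠ 1 := by
    rw [chiC, MulChar.ringHomComp_ne_one_iff (RingHom.injective_int _)]
    exact hne
  set f : ℂ → ℂ := fun s => (w : ℂ) * (riemannZeta s * DirichletCharacter.LFunction (chiC χ) s) with hf
  set g : ℂ → ℂ := fun s => ∑ C : T, (c : ℂ) ^ s * Ep (τ C).re (τ C).im s with hg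
  set U : Set ℂ := ({1/2, 1} : Set ℂ)ᶜ with hU
  have hUo : IsOpen U := (Set.toFinite _).isClosed.isOpen_compl
  have hUc : IsPreconnected U := by
    apply IsConnected.isPreconnected
    apply Set.Countable.isConnected_compl_of_one_lt_rank
    · rw [Complex.rank_real_complex]; norm_num
    · exact (Set.toFinite _).countable
  have hmemU : ∀ s ∈ U, s ≠ 1/2 ∧ s ≠ 1 := by
    intro s hs
    simp only [hU, Set.mem_compl_iff, Set.mem_insert_iff, Set.mem_singleton_iff, not_or] at hs
    exact hs
  have hfa : AnalyticOnNhd ℂ f U := by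
    apply DifferentiableOn.analyticOnNhd _ hUo
    intro s hs
    apply DifferentiableAt.differentiableWithinAt
    exact ((differentiableAt_riemannZeta (hmemU s hs).2).mul
      (DirichletCharacter.differentiable_LFunction hneC s)).const_mul _
  have hga : AnalyticOnNhd ℂ g U := by
    apply DifferentiableOn.analyticOnNhd _ hUo
    intro s hs
    apply DifferentiableAt.differentiableWithinAt
    apply DifferentiableAt.fun_sum
    intro C _
    exact ((differentiableAt_id).const_cpow (Or.inl hcC)).mul
      (Ep_differentiableAt (hτ C) (hmemU s hs).1 (hmemU s hs).2)
  have h2U : (2 : ℂ) ∈ U := by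
    simp only [hU, Set.mem_compl_iff, Set.mem_insert_iff, Set.mem_singleton_iff, not_or]
    norm_num
  have h0U : (0 : ℂ) ∈ U := by
    simp only [hU, Set.mem_compl_iff, Set.mem_insert_iff, Set.mem_singleton_iff, not_or]
    norm_num
  have hev : f =ᶠ[𝓝 2] g := by
    have : {s : ℂ | 1 < s.re} ∈ 𝓝 (2 : ℂ) :=
      (isOpen_lt continuous_const Complex.continuous_re).mem_nhds (by simp)
    filter_upwards [this] with s hs using hid s hs
  have hEq : Set.EqOn f g U := AnalyticOnNhd.eqOn_of_preconnected_of_eventuallyEq (𝕜 := ℂ)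
    hfa hga hUc h2U hev
  -- values at 0
  have hk := fun C => kronecker (x := (τ C).re) (hτ C)
  have hz0 : riemannZeta 0 = -1/2 := riemannZeta_zero
  have hval : (w : ℂ) * DirichletCharacter.LFunction (chiC χ) 0 = 2 * (Fintype.card T : ℂ) := by
    have h := hEq h0U
    simp only [hf, hg, Complex.cpow_zero, one_mul, hz0] at h
    rw [Finset.sum_congr rfl (fun C _ => (hk C).1), Finset.sum_const, Finset.card_univ, nsmul_eq_mul] at h
    linear_combination -2 * h
  -- derivatives at 0
  have hz1 : HasDerivAt riemannZeta (-(Real.log (2 * Real.pi) : ℂ) / 2) 0 := by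
    have h := (differentiableAt_riemannZeta (s := 0) (by norm_num)).hasDerivAt
    rw [deriv_riemannZeta_zero] at h
    rw [Complex.ofReal_log (by positivity)]
    push_cast
    exact h
  have hL := L_deriv hd1 χ hne
  set S : ℝ := ∑ a ∈ Finset.Ioo 0 d, ((χ (a : ZMod d) : ℤ) : ℝ) * Real.log (Real.Gamma (a / d)) with hS
  have hfd : HasDerivAt f _ 0 := (hz1.mul hL).const_mul (w : ℂ)
  have hpow : HasDerivAt (fun s : ℂ => (c : ℂ) ^ s) (Real.log c : ℂ) 0 := by
    have := (hasDerivAt_id (0 : ℂ)).const_cpow (c := (c : ℂ)) (Or.inl hcC)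
    rw [Complex.ofReal_log hc.le]
    simpa using! this
  have hgd : HasDerivAt g _ 0 :=
    HasDerivAt.fun_sum (u := Finset.univ) (fun C _ => hpow.mul (hk C).2)
  have hevfg : f =ᶠ[𝓝 0] g := by
    filter_upwards [hUo.mem_nhds h0U] with s hs using hEq hs
  have hder := (hevfg.hasDerivAt_iff.mp hfd).unique hgd
  simp only [hz0, Complex.cpow_zero, one_mul] at hder
  have h1 : ∀ C : T, (Real.log c : ℂ) * Ep (τ C).re (τ C).im 0 +
      ((-Real.log (τ C).im - 2*Real.log (2*Real.pi) -
        (1/6)*Real.log ‖RamanujanDelta ⟨(τ C).re, (τ C).im⟩‖ : ℝ) : ℂ) =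
      ((-Real.log c - Real.log (τ C).im - 2*Real.log (2*Real.pi) -
        (1/6)*Real.log ‖RamanujanDelta (τ C)‖ : ℝ) : ℂ) := by
    intro C
    rw [(hk C).1]
    push_cast
    ring
  rw [Finset.sum_congr rfl (fun C _ => h1 C), ← Complex.ofReal_sum] at hder
  have h2 : ((-(Fintype.card T : ℝ) * Real.log (2 * Real.pi) + (Fintype.card T : ℝ) * Real.log d
      - w * S / 2 : ℝ) : ℂ) = ((∑ C : T, (-Real.log c - Real.log (τ C).im - 2*Real.log (2*Real.pi) -
        (1/6)*Real.log ‖RamanujanDelta (τ C)‖) : ℝ) : ℂ) := by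
    rw [← hder]
    simp only [Complex.ofReal_add, Complex.ofReal_sub, Complex.ofReal_mul, Complex.ofReal_neg,
      Complex.ofReal_div, Complex.ofReal_natCast, Complex.ofReal_ofNat]
    linear_combination (-(Real.log d : ℂ) / 2 + (Real.log (2 * Real.pi) : ℂ) / 2) * hval
  have h3 := Complex.ofReal_injective h2
  have h4 : ∑ C : T, (12 * Real.log (2 * Real.pi * d) + (12 * Real.log (2 * (τ C).im / Real.sqrt d) +
      2 * Real.log ‖RamanujanDelta (τ C)‖)) =
      ∑ C : T, (-12 * (-Real.log c - Real.log (τ C).im - 2*Real.log (2*Real.pi) -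
        (1/6)*Real.log ‖RamanujanDelta (τ C)‖) + (12 * Real.log d - 12 * Real.log (2 * Real.pi))) := by
    apply Finset.sum_congr rfl
    intro C _
    have e1 : 2 * (τ C).im / Real.sqrt d = c * (τ C).im := by rw [hcdef]; ring
    rw [e1, Real.log_mul hc.ne' (hτ C).ne', Real.log_mul (by positivity) hdR.ne']
    ring
  rw [h4, Finset.sum_add_distrib, ← Finset.mul_sum, ← h3, Finset.sum_const, Finset.card_univ,
    nsmul_eq_mul]
  ring
end
end CS
end

/-- **The Chowla–Selberg formula.**
`E` is an imaginary quadratic field of discriminant `−d`, embedded in `ℂ` via `ι`, with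
class number `h`, number of roots of unity `w`, and attached primitive quadratic Dirichlet
character `χ` modulo `d`.  `D 𝔞 = Δ(𝔞)` is the value of Ramanujan's discriminant on the
lattice `ι(𝔞) = ℤω₁ + ℤω₂ ⊂ ℂ`, and `rep` selects a representative fractional ideal for
each ideal class.  Then
`(2πd)^{12h} ∏_{𝔞 ∈ CL(E)} Δ(𝔞)Δ(𝔞⁻¹) = ∏_{0 < a < d} Γ(a/d)^{6wχ(a)}`. -/
theorem chowla_selberg
    (E : Type*) [Field E] [NumberField E] (ι : E →+* ℂ)
    (d : ℕ) (hd : 0 < d)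
    (hdeg : Module.finrank ℚ E = 2)
    (hdisc : NumberField.discr E = -(d : ℤ))
    (h w : ℕ)
    (hh : h = NumberField.classNumber E)
    (hw : w = Nat.card (NumberField.Units.torsion E))
    (χ : DirichletCharacter ℤ d)
    (hχprim : χ.IsPrimitive)
    (hχquad : ∀ u : (ZMod d)ˣ, χ u = 1 ∨ χ u = -1)
    (hχ : ∀ p : ℕ, p.Prime → ¬ p ∣ d →
      (χ (p : ZMod d) = -1 ↔ (Ideal.span {(p : 𝓞 E)} : Ideal (𝓞 E)).IsPrime))
    (D : FractionalIdeal (𝓞 E)⁰ E → ℂ)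
    (hD : ∀ (𝔞 : FractionalIdeal (𝓞 E)⁰ E) (ω₁ ω₂ : ℂ), ω₂ ≠ 0 → 0 < (ω₁ / ω₂).im →
      (∀ z : ℂ, (∃ x : E, x ∈ 𝔞 ∧ ι x = z) ↔ ∃ m n : ℤ, z = m * ω₁ + n * ω₂) →
      D 𝔞 = ω₂ ^ (-12 : ℤ) * RamanujanDelta (ω₁ / ω₂))
    (rep : ClassGroup (𝓞 E) → (FractionalIdeal (𝓞 E)⁰ E)ˣ)
    (hrep : ∀ C, ClassGroup.mk E (rep C) = C) :
    ((2 * Real.pi * d : ℝ) : ℂ) ^ (12 * h) *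
        ∏ C : ClassGroup (𝓞 E), (D ↑(rep C) * D ↑((rep C)⁻¹)) =
      ∏ a ∈ Finset.Ioo 0 d, ((Real.Gamma (a / d) : ℂ)) ^ ((6 * w : ℤ) * χ (a : ZMod d)) := by
  classical
  have : NeZero d := ⟨hd.ne'⟩
  have hd2 : 2 < d := by
    have := NumberField.abs_discr_gt_two (K := E) (by rw [hdeg]; norm_num)
    rw [hdisc, abs_neg, Nat.abs_cast] at this
    exact_mod_cast this
  have hne : χ ≠ 1 := by
    rintro rfl
    have h1 : (1 : DirichletCharacter ℤ d).conductor = d := hχprim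
    rw [DirichletCharacter.conductor_one] at h1
    omega
  choose a b hmem hb him hcov using fun C => CS.exists_basis ι d hd hdeg hdisc (rep C)
  have hid := fun (s : ℂ) (hs : 1 < s.re) => CS.main_identity ι d hd hdeg hdisc χ hχquad hχ rep hrep
    (fun C => ι (a C) / ι (b C))
    (fun C => ⟨a C, b C, rfl, hmem C, hb C, him C, hcov C⟩) hs
  have key := CS.at_zero hd2 χ hne (fun C => ι (a C) / ι (b C)) him _ hid
  rw [← hw] at key
  have hDm := fun C => CS.D_mul ι d hd hdeg hdisc D hD (rep C) (a C) (b C) (hmem C) (hb C) (him C)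
    (hcov C)
  rw [Finset.prod_congr rfl (fun C _ => hDm C), ← Complex.ofReal_prod, ← Complex.ofReal_pow,
    ← Complex.ofReal_mul]
  have hdR : (0:ℝ) < d := by exact_mod_cast hd
  have hsd : 0 < Real.sqrt d := by positivity
  have hG : ∀ x ∈ Finset.Ioo 0 d, 0 < Real.Gamma (x / d) := by
    intro x hx
    rw [Finset.mem_Ioo] at hx
    apply Real.Gamma_pos_of_pos
    have : (0:ℝ) < x := by exact_mod_cast hx.1
    positivity
  have hΔ : ∀ C, 0 < ‖RamanujanDelta (ι (a C) / ι (b C))‖ := fun C =>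
    norm_pos_iff.mpr (CS.log_Delta (x := (ι (a C) / ι (b C)).re) (him C)).1
  have hy : ∀ C, 0 < 2 * (ι (a C) / ι (b C)).im / Real.sqrt d := fun C => by
    have := him C
    positivity
  have hpd : 0 < 2 * Real.pi * d := by positivity
  have hR : ∏ x ∈ Finset.Ioo 0 d, ((Real.Gamma (x / d) : ℂ)) ^ ((6 * w : ℤ) * χ (x : ZMod d)) =
      ((∏ x ∈ Finset.Ioo 0 d, (Real.Gamma (x / d)) ^ ((6 * w : ℤ) * χ (x : ZMod d)) : ℝ) : ℂ) := by
    rw [Complex.ofReal_prod]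
    apply Finset.prod_congr rfl
    intro x _
    rw [Complex.ofReal_zpow]
  rw [hR]
  congr 1
  have hLpos : ∀ C ∈ (Finset.univ : Finset (ClassGroup (𝓞 E))),
      (2 * (ι (a C) / ι (b C)).im / Real.sqrt d) ^ 12 *
        ‖RamanujanDelta (ι (a C) / ι (b C))‖ ^ 2 ≠ 0 := fun C _ =>
    (mul_pos (pow_pos (hy C) _) (pow_pos (hΔ C) _)).ne'
  apply Real.log_injOn_pos
  · exact mul_pos (pow_pos hpd _) (Finset.prod_pos fun C hC =>
      (mul_pos (pow_pos (hy C) _) (pow_pos (hΔ C) _)))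
  · exact Finset.prod_pos fun x hx => zpow_pos (hG x hx) _
  rw [Real.log_mul (pow_pos hpd _).ne' (Finset.prod_ne_zero_iff.mpr hLpos), Real.log_pow,
    Real.log_prod hLpos, Real.log_prod (fun x hx => (zpow_pos (hG x hx) _).ne')]
  have e1 : ∀ x ∈ Finset.Ioo 0 d, Real.log (Real.Gamma (x / d) ^ ((6 * w : ℤ) * χ (x : ZMod d))) =
      6 * (w : ℝ) * (((χ (x : ZMod d) : ℤ) : ℝ) * Real.log (Real.Gamma (x / d))) := by
    intro x _
    rw [Real.log_zpow]
    push_cast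
    ring
  have e2 : ∀ C ∈ (Finset.univ : Finset (ClassGroup (𝓞 E))),
      Real.log ((2 * (ι (a C) / ι (b C)).im / Real.sqrt d) ^ 12 *
        ‖RamanujanDelta (ι (a C) / ι (b C))‖ ^ 2) =
      12 * Real.log (2 * (ι (a C) / ι (b C)).im / Real.sqrt d) +
        2 * Real.log ‖RamanujanDelta (ι (a C) / ι (b C))‖ := by
    intro C _
    rw [Real.log_mul (pow_pos (hy C) _).ne' (pow_pos (hΔ C) _).ne', Real.log_pow, Real.log_pow]
    norm_num
  rw [Finset.sum_congr rfl e1, Finset.sum_congr rfl e2, ← Finset.mul_sum, key]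
  simp only [Finset.sum_add_distrib, Finset.sum_const, Finset.card_univ, nsmul_eq_mul]
  rw [hh, NumberField.classNumber]
  push_cast
  ring
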